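/- Let n be a positive integer and let T(n) denote the number of distinct prime divisors p of n with p^2 | n. If (ω(n) ≥ 18 and T(n) ≥ ω(n)/2), or (ω(n) ≥ 39 and T(n) ≥ ω(n)/3), or (ω(n) ≥ 969672728 and T(n) ≥ ω(n)/14), then σ(n)/n < e^γ · log(log n). -/

import Mathlib

open Real Finset


namespace RobinAux
open ArithmeticFunction (vonMangoldt)

noncomputable def TT (N : ℕ) : ℝ := ∑ m ∈ Ioc 0 N, Real.log m
noncomputable def LL (N : ℕ) : ℝ := ∑ m ∈ Ioc 0 N, Real.log m / m
noncomputable def HH (m : ℕ) : ℝ := ∑ j ∈ Ioc 0 m, (1 : ℝ) / j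
noncomputable def ps (N : ℕ) : ℝ := ∑ n ∈ Ioc 0 N, vonMangoldt n
noncomputable def VV (N : ℕ) : ℝ := ∑ n ∈ Ioc 0 N, vonMangoldt n * ((N : ℝ) / n - 1)

lemma dirichlet (f : ℕ → ℝ) (N : ℕ) :
    ∑ m ∈ Ioc 0 N, f m * Real.log m
      = ∑ n ∈ Ioc 0 N, vonMangoldt n * ∑ j ∈ Ioc 0 (N / n), f (n * j) := by
  have h1 : ∀ m ∈ Ioc 0 N, f m * Real.log m
      = ∑ n ∈ Ioc 0 N, if n ∣ m then vonMangoldt n * f m else 0 := by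
    intro m hm
    rw [mem_Ioc] at hm
    rw [← ArithmeticFunction.vonMangoldt_sum, mul_comm, Finset.sum_mul, ← Finset.sum_filter]
    apply Finset.sum_congr _ (fun _ _ => rfl)
    ext d
    simp only [Nat.mem_divisors, mem_filter, mem_Ioc]
    constructor
    · rintro ⟨h, _⟩
      exact ⟨⟨Nat.pos_of_dvd_of_pos h hm.1, (Nat.le_of_dvd hm.1 h).trans hm.2⟩, h⟩
    · rintro ⟨_, h⟩
      exact ⟨h, by omega⟩
  rw [Finset.sum_congr rfl h1, Finset.sum_comm]
  apply Finset.sum_congr rfl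
  intro n hn
  rw [mem_Ioc] at hn
  rw [← Finset.sum_filter, Finset.mul_sum]
  symm
  apply Finset.sum_bij (fun j _ => n * j)
  · intro j hj
    simp only [mem_Ioc, mem_filter] at *
    refine ⟨⟨Nat.mul_pos hn.1 hj.1, ?_⟩, dvd_mul_right _ _⟩
    calc n * j ≤ n * (N / n) := Nat.mul_le_mul_left _ hj.2
      _ ≤ N := Nat.mul_div_le _ _
  · intro a _ b _ h
    exact Nat.eq_of_mul_eq_mul_left hn.1 h
  · intro m hm
    simp only [mem_Ioc, mem_filter] at *
    obtain ⟨⟨h1, h2⟩, j, rfl⟩ := hm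
    exact ⟨j, ⟨Nat.pos_of_mul_pos_left h1, (Nat.le_div_iff_mul_le hn.1).2 (by linarith [mul_comm n j])⟩, rfl⟩
  · intro j _; rfl

lemma sum_extend (f : ℕ → ℝ) (N k : ℕ) (hf : ∀ n, N / k < n → f n = 0) :
    ∑ n ∈ Ioc 0 (N / k), f n = ∑ n ∈ Ioc 0 N, f n := by
  apply Finset.sum_subset
  · intro n hn
    rw [mem_Ioc] at *
    exact ⟨hn.1, hn.2.trans (Nat.div_le_self _ _)⟩
  · intro n _ h2
    apply hf
    rw [mem_Ioc] at *
    omega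

lemma TT_div (N k : ℕ) :
    TT (N / k) = ∑ n ∈ Ioc 0 N, vonMangoldt n * ((N / n / k : ℕ) : ℝ) := by
  have := dirichlet (fun _ => 1) (N / k)
  simp only [one_mul, Finset.sum_const, Nat.card_Ioc, nsmul_eq_mul, mul_one, tsub_zero] at this
  rw [TT, this, sum_extend]
  · apply Finset.sum_congr rfl
    intro n _
    rw [Nat.div_div_eq_div_mul, Nat.div_div_eq_div_mul, mul_comm k n]
  · intro n hn
    rw [Nat.div_eq_of_lt hn]; simp

lemma LL_div (N k : ℕ) :
    LL (N / k) = ∑ n ∈ Ioc 0 N, vonMangoldt n * (1 / n * HH (N / n / k)) := by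
  have := dirichlet (fun m => 1 / m) (N / k)
  rw [LL]
  have h2 : ∑ m ∈ Ioc 0 (N / k), Real.log m / m = ∑ m ∈ Ioc 0 (N / k), 1 / (m : ℝ) * Real.log m := by
    apply Finset.sum_congr rfl; intro m _; ring
  rw [h2, this, sum_extend]
  · apply Finset.sum_congr rfl
    intro n _
    rw [Nat.div_div_eq_div_mul, Nat.div_div_eq_div_mul, mul_comm k n, HH]
    congr 1
    rw [Finset.mul_sum]
    apply Finset.sum_congr rfl
    intro j _
    push_cast
    rw [one_div_mul_one_div]
  · intro n hn
    rw [Nat.div_eq_of_lt hn]; simp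

noncomputable def bb : ℝ := 5 * (1 - Real.log 2 / 2 - Real.log 3 / 3 - Real.log 5 / 6)

/-- error of the kernel approximation -/
noncomputable def EE (y : ℝ) (m : ℕ) : ℝ :=
  y - 1 - (y * (HH m - HH (m / 2) / 2 - HH (m / 3) / 3 - HH (m / 5) / 6)
    - m + (m / 2 : ℕ) + (m / 3 : ℕ) + (5 / 6 + bb) * (m / 5 : ℕ))

lemma VV_eq (N : ℕ) :
    VV N = N * (LL N - LL (N / 2) / 2 - LL (N / 3) / 3 - LL (N / 5) / 6)
      - TT N + TT (N / 2) + TT (N / 3) + (5 / 6 + bb) * TT (N / 5)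
      + ∑ n ∈ Ioc 0 N, vonMangoldt n * EE ((N : ℝ) / n) (N / n) := by
  have t1 := TT_div N 1
  have l1 := LL_div N 1
  simp only [Nat.div_one] at t1 l1
  rw [t1, l1, TT_div N 2, TT_div N 3, TT_div N 5, LL_div N 2, LL_div N 3, LL_div N 5, VV]
  simp only [Finset.mul_sum, Finset.sum_div, mul_sub, ← Finset.sum_sub_distrib, ← Finset.sum_add_distrib]
  apply Finset.sum_congr rfl
  intro n _
  rw [EE]
  ring

end RobinAux


namespace RobinAux

lemma HH_succ (m : ℕ) : HH (m + 1) = HH m + 1 / (m + 1) := by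
  rw [HH, HH, Finset.sum_Ioc_succ_top (Nat.zero_le m)]
  push_cast; rfl

lemma HH_zero : HH 0 = 0 := by simp [HH]

lemma HH_eq (m : ℕ) : HH m = (harmonic m : ℝ) := by
  induction m with
  | zero => simp [HH_zero]
  | succ k ih => rw [HH_succ, harmonic_succ, ih]; push_cast; rw [one_div]

lemma log_le_half {r : ℝ} (hr : 1 ≤ r) : Real.log r ≤ (r - r⁻¹) / 2 := by
  rw [← Real.sinh_log (by linarith)]
  exact Real.self_le_sinh_iff.2 (Real.log_nonneg hr)

lemma tendsto_HH : Filter.Tendsto (fun m : ℕ => HH m - Real.log m) Filter.atTop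
    (nhds Real.eulerMascheroniConstant) := by
  simpa [HH_eq] using Real.tendsto_harmonic_sub_log

lemma HH_le {m : ℕ} (hm : 1 ≤ m) :
    HH m ≤ Real.log m + Real.eulerMascheroniConstant + 1 / (2 * m) := by
  have hmono : Monotone (fun k : ℕ => HH (k + 1) - Real.log ((k + 1 : ℕ) : ℝ) - 1 / (2 * ((k + 1 : ℕ) : ℝ))) := by
    apply monotone_nat_of_le_succ
    intro k
    rw [HH_succ (k + 1)]
    have hk : (0 : ℝ) < ((k + 1 : ℕ) : ℝ) := by positivity
    set t : ℝ := ((k + 1 : ℕ) : ℝ) with ht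
    have h2 : ((k + 1 + 1 : ℕ) : ℝ) = t + 1 := by rw [ht]; push_cast; ring
    rw [h2]
    have h3 := log_le_half (r := (t + 1) / t) (by rw [le_div_iff₀ hk]; linarith)
    rw [Real.log_div (by positivity) hk.ne'] at h3
    have h4 : ((t + 1) / t - ((t + 1) / t)⁻¹) / 2 = 1 / (t + 1) - 1 / (2 * (t + 1)) + 1 / (2 * t) := by
      field_simp; ring
    linarith
  have hlim : Filter.Tendsto (fun k : ℕ => HH (k + 1) - Real.log ((k + 1 : ℕ) : ℝ) - 1 / (2 * ((k + 1 : ℕ) : ℝ)))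
      Filter.atTop (nhds (Real.eulerMascheroniConstant - 0)) := by
    apply Filter.Tendsto.sub
    · exact (Filter.tendsto_add_atTop_iff_nat (f := fun m : ℕ => HH m - Real.log m) 1).2 tendsto_HH
    · have := tendsto_one_div_add_atTop_nhds_zero_nat (𝕜 := ℝ)
      have h := this.const_mul (1 / 2 : ℝ)
      rw [mul_zero] at h
      refine h.congr (fun k => ?_)
      push_cast
      field_simp
  rw [sub_zero] at hlim
  have := hmono.ge_of_tendsto hlim (m - 1)
  simp only [Nat.sub_add_cancel hm] at this
  linarith

lemma le_HH (m : ℕ) :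
    Real.log (m + 1 / 2) + Real.eulerMascheroniConstant ≤ HH m := by
  have hanti : Antitone (fun k : ℕ => HH k - Real.log ((k : ℝ) + 1 / 2)) := by
    apply antitone_nat_of_succ_le
    intro k
    rw [HH_succ k]
    have hk : (0 : ℝ) ≤ (k : ℝ) := by positivity
    push_cast
    have h3 := Real.le_log_one_add_of_nonneg (x := 1 / ((k : ℝ) + 1 / 2)) (by positivity)
    have h5 : 1 + 1 / ((k : ℝ) + 1 / 2) = ((k : ℝ) + 1 + 1 / 2) / (k + 1 / 2) := by field_simp; ring
    rw [h5, Real.log_div (by positivity) (by positivity)] at h3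
    have h4 : 2 * (1 / ((k : ℝ) + 1 / 2)) / (1 / ((k : ℝ) + 1 / 2) + 2) = 1 / (k + 1) := by
      field_simp; ring
    linarith
  have hlim : Filter.Tendsto (fun k : ℕ => HH k - Real.log ((k : ℝ) + 1 / 2))
      Filter.atTop (nhds (Real.eulerMascheroniConstant)) := by
    have h1 : Filter.Tendsto (fun k : ℕ => HH k - Real.log ((k : ℝ)) - Real.log (1 + (1 / 2) / (k : ℝ)))
      Filter.atTop (nhds (Real.eulerMascheroniConstant - Real.log (1 + 0))) := by
      apply tendsto_HH.sub
      apply Filter.Tendsto.log _ (by norm_num)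
      exact (tendsto_const_div_atTop_nhds_zero_nat (1 / 2 : ℝ)).const_add 1
    simp only [add_zero, Real.log_one, sub_zero] at h1
    refine h1.congr' ?_
    filter_upwards [Filter.eventually_gt_atTop 0] with k hk
    have hk' : (0 : ℝ) < k := by exact_mod_cast hk
    rw [sub_sub, ← Real.log_mul (by positivity) (by positivity)]
    congr 2
    field_simp
  have := hanti.le_of_tendsto hlim m
  linarith

noncomputable def jj (y : ℝ) (m : ℕ) : ℝ :=
  y * HH m - m - y * Real.log y - (Real.eulerMascheroniConstant - 1) * y - 1 / 2

lemma jj_le {y : ℝ} {m : ℕ} (hm : 1 ≤ m) (h1 : (m : ℝ) ≤ y) (h2 : y ≤ m + 1) :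
    jj y m ≤ 1 / (8 * m) + 1 / (16 * m ^ 2) := by
  have hm' : (1 : ℝ) ≤ m := by exact_mod_cast hm
  have hy : 0 < y := by linarith
  have a1 := mul_le_mul_of_nonneg_left (HH_le hm) hy.le
  have a2 := Real.le_log_one_add_of_nonneg (x := (y - m) / m) (by apply div_nonneg <;> linarith)
  have a3 : 1 + (y - m) / m = y / m := by field_simp; ring
  have a4 : 2 * ((y - m) / m) / ((y - m) / m + 2) = 2 * (y - m) / (y + m) := by
    have : (0 : ℝ) < m := by linarith
    rw [div_eq_div_iff (by have : 0 ≤ (y - m) / m := by apply div_nonneg <;> linarith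
                           positivity) (by positivity)]
    field_simp; ring
  rw [a3, Real.log_div hy.ne' (by positivity), a4] at a2
  have a5 := mul_le_mul_of_nonneg_left a2 hy.le
  rw [jj]
  have b1 : y * (2 * (y - m) / (y + m)) = (y - m) + (y - m) ^ 2 / (y + m) := by
    field_simp; ring
  have b2 : (y - m) ^ 2 / (2 * m + 1) ≤ (y - m) ^ 2 / (y + m) := by
    apply div_le_div_of_nonneg_left (by positivity) (by positivity) (by linarith)
  have b3 : (y - m) / (2 * m) - (y - m) ^ 2 / (2 * m + 1) ≤ 1 / (8 * m) + 1 / (16 * m ^ 2) := by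
    have : 1 / (8 * (m : ℝ)) + 1 / (16 * m ^ 2) - ((y - m) / (2 * m) - (y - m) ^ 2 / (2 * m + 1))
        = ((y - m) - (2 * m + 1) / (4 * m)) ^ 2 / (2 * m + 1) := by
      field_simp; ring
    have h0 : 0 ≤ ((y - m) - (2 * m + 1) / (4 * m)) ^ 2 / (2 * (m : ℝ) + 1) := by positivity
    linarith
  have b4 : y * (1 / (2 * m)) = 1 / 2 + (y - m) / (2 * m) := by field_simp; ring
  nlinarith

lemma le_jj {y : ℝ} {m : ℕ} (hm : 1 ≤ m) (h1 : (m : ℝ) ≤ y) (h2 : y ≤ m + 1) :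
    -(1 / (4 * m + 2)) ≤ jj y m := by
  have hm' : (1 : ℝ) ≤ m := by exact_mod_cast hm
  have hy : 0 < y := by linarith
  have a1 := mul_le_mul_of_nonneg_left (le_HH m) hy.le
  have a2 := Real.one_sub_inv_le_log_of_pos (x := ((m : ℝ) + 1 / 2) / y) (by positivity)
  rw [Real.log_div (by positivity) hy.ne', inv_div] at a2
  have a5 := mul_le_mul_of_nonneg_left a2 hy.le
  rw [jj]
  have b1 : y * (1 - y / (m + 1 / 2)) + (y - m) - 1 / 2 = - ((y - m - 1 / 2) ^ 2 / (m + 1 / 2)) := by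
    field_simp; ring
  have b2 : (y - m - 1 / 2) ^ 2 / ((m : ℝ) + 1 / 2) ≤ 1 / (4 * m + 2) := by
    have h3 : (y - m - 1 / 2) ^ 2 ≤ 1 / 4 := by nlinarith
    rw [div_le_div_iff₀ (by positivity) (by positivity)]
    nlinarith
  nlinarith

end RobinAux


namespace RobinAux

lemma bb_gt : (0.094913 : ℝ) < bb := by
  have := Real.log_two_lt_d9; have := Real.log_three_lt_d9; have := Real.log_five_lt_d9
  rw [bb]; linarith
lemma bb_lt : bb < (0.094914 : ℝ) := by
  have := Real.log_two_gt_d9; have := Real.log_three_gt_d9; have := Real.log_five_gt_d9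
  rw [bb]; linarith

def hq : ℕ → ℚ
  | 0 => 0
  | n + 1 => hq n + 1 / (n + 1)

lemma HH_hq (m : ℕ) : HH m = (hq m : ℝ) := by
  induction m with
  | zero => simp [HH_zero, hq]
  | succ k ih => rw [HH_succ, hq, ih]; push_cast; rfl

def eq0 (y : ℚ) (m : ℕ) : ℚ :=
  y - 1 - (y * (hq m - hq (m / 2) / 2 - hq (m / 3) / 3 - hq (m / 5) / 6)
    - m + (m / 2 : ℕ) + (m / 3 : ℕ) + (5 / 6 + 949135 / 10000000) * (m / 5 : ℕ))

def eqchk (m : ℕ) : Bool :=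
  decide (-1299/10000 ≤ eq0 m m ∧ eq0 m m ≤ 299/10000 ∧ -1299/10000 ≤ eq0 (m + 1) m ∧ eq0 (m + 1) m ≤ 299/10000)

set_option maxRecDepth 100000 in
lemma eqchk_all : (List.range 100).all (fun m => decide (m < 5) || eqchk m) = true := by
  decide +kernel

lemma EE_small {y : ℝ} {m : ℕ} (hm : 1 ≤ m) (hm5 : m < 5) : EE y m = 0 := by
  rw [EE]
  simp only [HH_hq]
  interval_cases m <;> norm_num [hq] <;> ring

lemma EE_jj (y : ℝ) (m : ℕ) (hy : 0 < y) : EE y m = -1 / 12 + bb * (y / 5 - (m / 5 : ℕ))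
    - (jj y m - jj (y / 2) (m / 2) - jj (y / 3) (m / 3) - 5 / 6 * jj (y / 5) (m / 5)) := by
  rw [EE, jj, jj, jj, jj, Real.log_div hy.ne' (by norm_num), Real.log_div hy.ne' (by norm_num),
    Real.log_div hy.ne' (by norm_num), bb]
  ring

lemma floor_div {y : ℝ} {m : ℕ} (k : ℕ) (hk : 0 < k) (h1 : (m : ℝ) ≤ y) (h2 : y ≤ m + 1) :
    ((m / k : ℕ) : ℝ) ≤ y / k ∧ y / k ≤ ((m / k : ℕ) : ℝ) + 1 := by
  have hk' : (0 : ℝ) < k := by exact_mod_cast hk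
  constructor
  · rw [le_div_iff₀ hk']
    have : ((m / k * k : ℕ) : ℝ) ≤ m := by exact_mod_cast Nat.div_mul_le_self m k
    push_cast at this; linarith
  · rw [div_le_iff₀ hk']
    have : ((m + 1 : ℕ) : ℝ) ≤ (((m / k + 1) * k : ℕ) : ℝ) := by
      exact_mod_cast Nat.lt_mul_of_div_lt (Nat.lt_succ_self _) hk
    push_cast at this; linarith

lemma EE_big {y : ℝ} {m : ℕ} (hm : 100 ≤ m) (h1 : (m : ℝ) ≤ y) (h2 : y ≤ m + 1) :
    -0.13 ≤ EE y m ∧ EE y m ≤ 0.03 := by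
  have hm' : (100 : ℝ) ≤ m := by exact_mod_cast hm
  obtain ⟨c1, d1⟩ := floor_div 2 (by norm_num) h1 h2
  obtain ⟨c2, d2⟩ := floor_div 3 (by norm_num) h1 h2
  obtain ⟨c3, d3⟩ := floor_div 5 (by norm_num) h1 h2
  rw [EE_jj y m (by linarith)]
  push_cast at *
  have gen : ∀ (z : ℝ) (q q0 : ℕ), 1 ≤ q0 → q0 ≤ q → (q : ℝ) ≤ z → z ≤ q + 1 →
      jj z q ≤ 1 / (8 * q0) + 1 / (16 * q0 ^ 2) ∧ -(1 / (4 * (q0:ℝ) + 2)) ≤ jj z q := by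
    intro z q q0 hq hq0 a b
    have e1 : (1 : ℝ) ≤ q0 := by exact_mod_cast hq
    have e2 : (q0 : ℝ) ≤ q := by exact_mod_cast hq0
    constructor
    · refine (jj_le (hq.trans hq0) a b).trans ?_
      gcongr
    · refine le_trans ?_ (le_jj (hq.trans hq0) a b)
      apply neg_le_neg
      gcongr
  have g1 := gen y m 100 (by norm_num) hm h1 h2
  have g2 := gen (y / 2) (m / 2) 50 (by norm_num) (by omega) c1 d1
  have g3 := gen (y / 3) (m / 3) 33 (by norm_num) (by omega) c2 d2
  have g4 := gen (y / 5) (m / 5) 20 (by norm_num) (by omega) c3 d3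
  norm_num at g1 g2 g3 g4
  have b1 := bb_gt
  have b2 := bb_lt
  have p0 : 0 ≤ bb * (y / 5 - (m / 5 : ℕ)) := mul_nonneg (by linarith) (by linarith)
  have p1 : bb * (y / 5 - (m / 5 : ℕ)) ≤ 0.094914 * 1 := by
    apply mul_le_mul b2.le (by linarith) (by linarith) (by norm_num)
  constructor <;> linarith [g1.1, g1.2, g2.1, g2.2, g3.1, g3.2, g4.1, g4.2]

lemma EE_mid {y : ℝ} {m : ℕ} (hm5 : 5 ≤ m) (hm : m < 100) (h1 : (m : ℝ) ≤ y) (h2 : y ≤ m + 1) :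
    -0.13 ≤ EE y m ∧ EE y m ≤ 0.03 := by
  have hc := eqchk_all
  rw [List.all_eq_true] at hc
  have hc2 := hc m (List.mem_range.2 hm)
  have h5 : decide (m < 5) = false := by simpa using hm5
  rw [h5, Bool.false_or, eqchk, decide_eq_true_eq] at hc2
  have key : ∀ t : ℚ, EE t m = ((eq0 t m : ℚ) : ℝ) - (bb - 949135 / 10000000) * (m / 5 : ℕ) := by
    intro t
    rw [EE, eq0, HH_hq, HH_hq, HH_hq, HH_hq]
    push_cast
    ring
  have k1 := key m
  have k2 := key (m + 1)
  obtain ⟨i1, i2, i3, i4⟩ := hc2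
  have i1' : ((-1299 / 10000 : ℚ) : ℝ) ≤ ((eq0 m m : ℚ) : ℝ) := by exact_mod_cast i1
  have i2' : ((eq0 m m : ℚ) : ℝ) ≤ ((299 / 10000 : ℚ) : ℝ) := by exact_mod_cast i2
  have i3' : ((-1299 / 10000 : ℚ) : ℝ) ≤ ((eq0 (m + 1) m : ℚ) : ℝ) := by exact_mod_cast i3
  have i4' : ((eq0 (m + 1) m : ℚ) : ℝ) ≤ ((299 / 10000 : ℚ) : ℝ) := by exact_mod_cast i4
  have b1 := bb_gt
  have b2 := bb_lt
  have hm20 : ((m / 5 : ℕ) : ℝ) ≤ 20 := by exact_mod_cast (by omega : m / 5 ≤ 20)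
  have hm0 : (0 : ℝ) ≤ ((m / 5 : ℕ) : ℝ) := by positivity
  have e1 : |(bb - 949135 / 10000000) * ((m / 5 : ℕ) : ℝ)| ≤ 0.000001 * 20 := by
    rw [abs_mul, abs_of_nonneg hm0]
    apply mul_le_mul _ hm20 hm0 (by norm_num)
    rw [abs_le]; constructor <;> linarith
  rw [abs_le] at e1
  have lin : EE y m = (m + 1 - y) * EE ((m : ℚ) : ℝ) m + (y - m) * EE ((m + 1 : ℚ) : ℝ) m := by
    rw [EE, EE, EE]; push_cast; ring
  push_cast at i1' i2' i3' i4'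
  have j1 : -0.13 ≤ EE ((m : ℚ) : ℝ) m := by rw [k1]; linarith
  have j2 : EE ((m : ℚ) : ℝ) m ≤ 0.03 := by rw [k1]; linarith
  have j3 : -0.13 ≤ EE ((m + 1 : ℚ) : ℝ) m := by rw [k2]; linarith
  have j4 : EE ((m + 1 : ℚ) : ℝ) m ≤ 0.03 := by rw [k2]; linarith
  rw [lin]
  constructor <;> nlinarith

lemma EE_bd {y : ℝ} {m : ℕ} (hm5 : 5 ≤ m) (h1 : (m : ℝ) ≤ y) (h2 : y ≤ m + 1) :
    -0.13 ≤ EE y m ∧ EE y m ≤ 0.03 := by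
  by_cases h : m < 100
  · exact EE_mid hm5 h h1 h2
  · exact EE_big (by omega) h1 h2

lemma ps_nonneg (N : ℕ) : 0 ≤ ps N :=
  Finset.sum_nonneg (fun _ _ => ArithmeticFunction.vonMangoldt_nonneg)

lemma sumEE_bd (N : ℕ) :
    -0.13 * ps (N / 5) ≤ ∑ n ∈ Ioc 0 N, ArithmeticFunction.vonMangoldt n * EE ((N : ℝ) / n) (N / n) ∧
    ∑ n ∈ Ioc 0 N, ArithmeticFunction.vonMangoldt n * EE ((N : ℝ) / n) (N / n) ≤ 0.03 * ps (N / 5) := by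
  have hsub : ∑ n ∈ Ioc 0 (N / 5), ArithmeticFunction.vonMangoldt n * EE ((N : ℝ) / n) (N / n)
      = ∑ n ∈ Ioc 0 N, ArithmeticFunction.vonMangoldt n * EE ((N : ℝ) / n) (N / n) := by
    apply Finset.sum_subset
    · intro n hn
      rw [mem_Ioc] at *
      omega
    · intro n hn h2
      rw [mem_Ioc] at *
      rw [EE_small, mul_zero]
      · exact Nat.div_pos hn.2 hn.1
      · rw [Nat.div_lt_iff_lt_mul hn.1]; omega
  rw [← hsub, ps, Finset.mul_sum, Finset.mul_sum]
  have key : ∀ n ∈ Ioc 0 (N / 5), -0.13 ≤ EE ((N : ℝ) / n) (N / n) ∧ EE ((N : ℝ) / n) (N / n) ≤ 0.03 := by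
    intro n hn
    rw [mem_Ioc] at hn
    have := floor_div (y := N) (m := N) n hn.1 le_rfl (by linarith)
    apply EE_bd _ this.1 this.2
    rw [Nat.le_div_iff_mul_le hn.1]; omega
  constructor
  · apply Finset.sum_le_sum
    intro n hn
    have := mul_le_mul_of_nonneg_left (key n hn).1 (ArithmeticFunction.vonMangoldt_nonneg (n := n))
    linarith
  · apply Finset.sum_le_sum
    intro n hn
    have := mul_le_mul_of_nonneg_left (key n hn).2 (ArithmeticFunction.vonMangoldt_nonneg (n := n))
    linarith

end RobinAux


namespace RobinAux
open ArithmeticFunction (vonMangoldt)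

noncomputable def ff (z : ℝ) : ℝ := z * Real.log z - z + 1

lemma ff_diff {a b : ℝ} (ha : 0 < a) (hab : a ≤ b) :
    (b - a) * Real.log a ≤ ff b - ff a ∧ ff b - ff a ≤ (b - a) * Real.log b := by
  have hb : 0 < b := by linarith
  have h1 := Real.log_le_sub_one_of_pos (x := b / a) (by positivity)
  have h2 := Real.one_sub_inv_le_log_of_pos (x := b / a) (by positivity)
  rw [Real.log_div hb.ne' ha.ne'] at h1 h2
  have h1' := mul_le_mul_of_nonneg_left h1 ha.le
  have h2' := mul_le_mul_of_nonneg_left h2 hb.le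
  have e1 : a * (b / a - 1) = b - a := by field_simp
  have e2 : b * (1 - (b / a)⁻¹) = b - a := by field_simp
  rw [e1] at h1'
  rw [e2] at h2'
  rw [ff, ff]
  constructor <;> nlinarith

lemma TT_succ (N : ℕ) : TT (N + 1) = TT N + Real.log (N + 1) := by
  rw [TT, TT, Finset.sum_Ioc_succ_top (Nat.zero_le N)]; push_cast; rfl

lemma LL_succ (N : ℕ) : LL (N + 1) = LL N + Real.log (N + 1) / (N + 1) := by
  rw [LL, LL, Finset.sum_Ioc_succ_top (Nat.zero_le N)]; push_cast; rfl

lemma TT_bd (N : ℕ) (hN : 1 ≤ N) : ff N ≤ TT N ∧ TT N ≤ ff N + Real.log N := by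
  induction N, hN using Nat.le_induction with
  | base => simp [ff, TT]
  | succ k hk ih =>
    have hk' : (1 : ℝ) ≤ k := by exact_mod_cast hk
    have := ff_diff (a := k) (b := k + 1) (by linarith) (by linarith)
    rw [TT_succ]
    push_cast
    constructor <;> linarith [ih.1, ih.2, this.1, this.2]

lemma TT_real {z : ℝ} {m : ℕ} (hm : 1 ≤ m) (h1 : (m : ℝ) ≤ z) (h2 : z ≤ m + 1) :
    ff z - Real.log z ≤ TT m ∧ TT m ≤ ff z + Real.log z := by
  have hm' : (1 : ℝ) ≤ m := by exact_mod_cast hm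
  have h := ff_diff (a := m) (b := z) (by linarith) h1
  have h3 := TT_bd m hm
  have l0 : 0 ≤ Real.log m := Real.log_nonneg hm'
  have l1 : Real.log m ≤ Real.log z := Real.log_le_log (by linarith) h1
  constructor
  · nlinarith [h.2]
  · nlinarith [h.1]

lemma TT_div_bd (N k : ℕ) (hk : 0 < k) (hN : k ≤ N) :
    ff (N / k : ℝ) - Real.log N ≤ TT (N / k) ∧ TT (N / k) ≤ ff (N / k : ℝ) + Real.log N := by
  have := floor_div (y := N) (m := N) k hk le_rfl (by linarith)
  have h2 := TT_real (Nat.div_pos hN hk) this.1 this.2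
  have hk' : (1 : ℝ) ≤ k := by exact_mod_cast hk
  have hN' : (k : ℝ) ≤ N := by exact_mod_cast hN
  have h3 : Real.log (N / k : ℝ) ≤ Real.log N := by
    apply Real.log_le_log (by apply div_pos <;> linarith)
    apply div_le_self <;> linarith
  constructor <;> linarith [h2.1, h2.2]

lemma cheb_c (m : ℕ) : m / 2 + m / 3 + m / 5 ≤ m + m / 30 ∧ m + m / 30 ≤ m / 2 + m / 3 + m / 5 + 1 := by
  omega

noncomputable def SS (N : ℕ) : ℝ := TT N - TT (N / 2) - TT (N / 3) - TT (N / 5) + TT (N / 30)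

lemma SS_eq (N : ℕ) : SS N = ∑ n ∈ Ioc 0 N, vonMangoldt n *
    (((N / n : ℕ) : ℝ) - (N / n / 2 : ℕ) - (N / n / 3 : ℕ) - (N / n / 5 : ℕ) + (N / n / 30 : ℕ)) := by
  have t1 := TT_div N 1
  simp only [Nat.div_one] at t1
  rw [SS, t1, TT_div N 2, TT_div N 3, TT_div N 5, TT_div N 30]
  simp only [← Finset.sum_sub_distrib, ← Finset.sum_add_distrib]
  apply Finset.sum_congr rfl
  intro n _
  ring

lemma SS_le (N : ℕ) : SS N ≤ ps N := by
  rw [SS_eq, ps]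
  apply Finset.sum_le_sum
  intro n _
  have h := (cheb_c (N / n)).2
  have h' : ((N / n : ℕ) : ℝ) + (N / n / 30 : ℕ) ≤ (N / n / 2 : ℕ) + (N / n / 3 : ℕ) + (N / n / 5 : ℕ) + 1 := by
    exact_mod_cast h
  have := mul_le_mul_of_nonneg_left (a := vonMangoldt n) (b := (((N / n : ℕ) : ℝ) - (N / n / 2 : ℕ) - (N / n / 3 : ℕ) - (N / n / 5 : ℕ) + (N / n / 30 : ℕ))) (c := 1) (by linarith) ArithmeticFunction.vonMangoldt_nonneg
  linarith

lemma le_SS (N : ℕ) : ps N - ps (N / 6) ≤ SS N := by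
  have h1 : ps (N / 6) = ∑ n ∈ Ioc 0 N, if n ≤ N / 6 then vonMangoldt n else 0 := by
    rw [ps, ← Finset.sum_filter]
    apply Finset.sum_congr _ (fun _ _ => rfl)
    ext n
    simp only [mem_filter, mem_Ioc]
    omega
  rw [SS_eq, h1, ps, ← Finset.sum_sub_distrib]
  apply Finset.sum_le_sum
  intro n hn
  rw [mem_Ioc] at hn
  split_ifs with h
  · rw [sub_self]
    apply mul_nonneg ArithmeticFunction.vonMangoldt_nonneg
    have h := (cheb_c (N / n)).1
    have h' : ((N / n / 2 : ℕ) : ℝ) + (N / n / 3 : ℕ) + (N / n / 5 : ℕ) ≤ (N / n : ℕ) + (N / n / 30 : ℕ) := by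
      exact_mod_cast h
    linarith
  · have e1 : 1 ≤ N / n := Nat.div_pos hn.2 hn.1
    have e2 : N / n < 6 := by rw [Nat.div_lt_iff_lt_mul hn.1]; omega
    rw [sub_zero]
    generalize N / n = q at *
    interval_cases q <;> norm_num

lemma SS_bd (N : ℕ) (hN : 30 ≤ N) :
    0.92129 * N - 1 - 5 * Real.log N ≤ SS N ∧ SS N ≤ 0.92130 * N - 1 + 5 * Real.log N := by
  have t1 := TT_div_bd N 1 (by norm_num) (by omega)
  have t2 := TT_div_bd N 2 (by norm_num) (by omega)
  have t3 := TT_div_bd N 3 (by norm_num) (by omega)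
  have t5 := TT_div_bd N 5 (by norm_num) (by omega)
  have t30 := TT_div_bd N 30 (by norm_num) (by omega)
  rw [Nat.div_one] at t1
  have hN' : (30 : ℝ) ≤ N := by exact_mod_cast hN
  have hN0 : (N : ℝ) ≠ 0 := by positivity
  have key : ff (N / (1 : ℕ) : ℝ) - ff (N / (2 : ℕ) : ℝ) - ff (N / (3 : ℕ) : ℝ) - ff (N / (5 : ℕ) : ℝ) + ff (N / (30 : ℕ) : ℝ)
      = N * (Real.log 2 / 2 + Real.log 3 / 3 + Real.log 5 / 5 - (Real.log 2 + Real.log 3 + Real.log 5) / 30) - 1 := by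
    have h30 : Real.log 30 = Real.log 2 + Real.log 3 + Real.log 5 := by
      rw [← Real.log_mul (by norm_num) (by norm_num), ← Real.log_mul (by norm_num) (by norm_num)]; norm_num
    push_cast
    rw [ff, ff, ff, ff, ff, Real.log_div hN0 (by norm_num), Real.log_div hN0 (by norm_num),
      Real.log_div hN0 (by norm_num), Real.log_div hN0 (by norm_num), Real.log_div hN0 (by norm_num), h30, Real.log_one]
    ring
  have a1 := Real.log_two_lt_d9; have a2 := Real.log_three_lt_d9; have a3 := Real.log_five_lt_d9
  have b1 := Real.log_two_gt_d9; have b2 := Real.log_three_gt_d9; have b3 := Real.log_five_gt_d9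
  have u1 : Real.log 2 / 2 + Real.log 3 / 3 + Real.log 5 / 5 - (Real.log 2 + Real.log 3 + Real.log 5) / 30 ≤ 0.92130 := by linarith
  have u2 : 0.92129 ≤ Real.log 2 / 2 + Real.log 3 / 3 + Real.log 5 / 5 - (Real.log 2 + Real.log 3 + Real.log 5) / 30 := by linarith
  have v1 := mul_le_mul_of_nonneg_left u1 (by linarith : (0:ℝ) ≤ N)
  have v2 := mul_le_mul_of_nonneg_left u2 (by linarith : (0:ℝ) ≤ N)
  rw [SS]
  constructor <;> linarith [t1.1, t1.2, t2.1, t2.2, t3.1, t3.2, t5.1, t5.2, t30.1, t30.2]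

lemma le_ps (N : ℕ) (hN : 30 ≤ N) : 0.92129 * N - 1 - 5 * Real.log N ≤ ps N :=
  (SS_bd N hN).1.trans (SS_le N)

lemma ps_triv (N : ℕ) (hN : 1 ≤ N) : ps N ≤ N * Real.log N := by
  rw [ps]
  calc ∑ n ∈ Ioc 0 N, vonMangoldt n ≤ ∑ n ∈ Ioc 0 N, Real.log N := by
        apply Finset.sum_le_sum
        intro n hn
        rw [mem_Ioc] at hn
        refine ArithmeticFunction.vonMangoldt_le_log.trans ?_
        apply Real.log_le_log (by exact_mod_cast hn.1) (by exact_mod_cast hn.2)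
    _ = N * Real.log N := by simp

lemma ps_le (N : ℕ) (hN : 1 ≤ N) : ps N ≤ 1.1056 * N + 1.5 * (Real.log N + 1) ^ 2 + 101 := by
  induction N using Nat.strong_induction_on with
  | _ N ih =>
    have hN1 : (1 : ℝ) ≤ N := by exact_mod_cast hN
    have hl : 0 ≤ Real.log N := Real.log_nonneg hN1
    by_cases h : N < 30
    · have h1 := ps_triv N hN
      have h2 : Real.log N ≤ Real.log (2 ^ 5) := by
        apply Real.log_le_log (by linarith)
        have : (N : ℝ) < 30 := by exact_mod_cast h
        linarith
      rw [Real.log_pow] at h2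
      have := Real.log_two_lt_d9
      have h3 : (N : ℝ) ≤ 29 := by exact_mod_cast (by omega : N ≤ 29)
      push_cast at h2
      nlinarith
    · have hN30 : 30 ≤ N := by omega
      have h6 := ih (N / 6) (by omega) (by omega)
      have h7 := le_SS N
      have h8 := (SS_bd N hN30).2
      have hq : ((N / 6 : ℕ) : ℝ) ≤ N / 6 := by
        have := (floor_div (y := N) (m := N) 6 (by norm_num) le_rfl (by linarith)).1
        exact_mod_cast this
      have hq1 : (1 : ℝ) ≤ ((N / 6 : ℕ) : ℝ) := by exact_mod_cast (by omega : 1 ≤ N / 6)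
      have l6 : Real.log 6 = Real.log 2 + Real.log 3 := by
        rw [← Real.log_mul (by norm_num) (by norm_num)]; norm_num
      have hl6 : Real.log ((N / 6 : ℕ) : ℝ) ≤ Real.log N - Real.log 6 := by
        rw [← Real.log_div (by linarith) (by norm_num)]
        exact Real.log_le_log (by linarith) hq
      have hl0 : 0 ≤ Real.log ((N / 6 : ℕ) : ℝ) := Real.log_nonneg hq1
      have b1 := Real.log_two_gt_d9; have b2 := Real.log_three_gt_d9
      have hl7 : Real.log ((N / 6 : ℕ) : ℝ) ≤ Real.log N - 1.79 := by linarith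
      have : (Real.log ((N / 6 : ℕ) : ℝ) + 1) ^ 2 ≤ (Real.log N - 0.79) ^ 2 := by
        apply pow_le_pow_left₀ (by linarith); linarith
      nlinarith

end RobinAux


namespace RobinAux
open ArithmeticFunction (vonMangoldt)

lemma sq_diff {a b : ℝ} (ha : 3 ≤ a) (hab : a ≤ b) :
    (b - a) * (Real.log b / b) ≤ Real.log b ^ 2 / 2 - Real.log a ^ 2 / 2 ∧
    Real.log b ^ 2 / 2 - Real.log a ^ 2 / 2 ≤ (b - a) * (Real.log a / a) := by
  rcases hab.eq_or_lt with rfl | hlt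
  · simp
  have hd : ∀ x : ℝ, 0 < x → HasDerivAt (fun t => Real.log t ^ 2 / 2) (Real.log x / x) x := by
    intro x hx
    have := ((Real.hasDerivAt_log hx.ne').pow 2).div_const 2
    refine this.congr_deriv ?_
    field_simp
    ring
  obtain ⟨c, hc, he⟩ := exists_hasDerivAt_eq_slope (fun t => Real.log t ^ 2 / 2) (fun t => Real.log t / t) hlt
    (fun x hx => (hd x (by linarith [hx.1])).continuousAt.continuousWithinAt)
    (fun x hx => hd x (by linarith [hx.1]))
  have hba : 0 < b - a := by linarith
  have he' : Real.log b ^ 2 / 2 - Real.log a ^ 2 / 2 = (b - a) * (Real.log c / c) := by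
    rw [he]; field_simp
  rw [he']
  have e3 : Real.exp 1 ≤ 3 := by linarith [Real.exp_one_lt_d9]
  have hanti := Real.log_div_self_antitoneOn
  constructor
  · apply mul_le_mul_of_nonneg_left _ hba.le
    exact hanti (by simp; linarith [hc.1]) (by simp; linarith) hc.2.le
  · apply mul_le_mul_of_nonneg_left _ hba.le
    exact hanti (by simp; linarith) (by simp; linarith [hc.1]) hc.1.le

noncomputable def uu (m : ℕ) : ℝ := LL m - Real.log m ^ 2 / 2

lemma uu_bd (a b : ℕ) (ha : 3 ≤ a) (hab : a ≤ b) :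
    uu b ≤ uu a ∧ uu a - Real.log a / a + Real.log b / b ≤ uu b := by
  induction b, hab using Nat.le_induction with
  | base => simp
  | succ k hk ih =>
    have hk3 : (3 : ℝ) ≤ k := by exact_mod_cast ha.trans hk
    have h := sq_diff (a := k) (b := k + 1) hk3 (by linarith)
    rw [uu, LL_succ]
    rw [uu] at ih
    push_cast
    constructor
    · have := h.1
      rw [uu] at *
      linarith [ih.1]
    · have := h.2
      rw [uu] at *
      linarith [ih.2]

lemma LL_div_bd (N k : ℕ) (hk : 1 ≤ k) (hk5 : k ≤ 5) (hN : 1000 ≤ N) :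
    -(10.2 * Real.log N / N) ≤ LL (N / k) - uu (N / 5) - Real.log (N / k : ℝ) ^ 2 / 2 ∧
    LL (N / k) - uu (N / 5) - Real.log (N / k : ℝ) ^ 2 / 2 ≤ 0 := by
  have hk' : (1 : ℝ) ≤ k := by exact_mod_cast hk
  have hk5' : (k : ℝ) ≤ 5 := by exact_mod_cast hk5
  have hN' : (1000 : ℝ) ≤ N := by exact_mod_cast hN
  have h5 : N / 5 ≤ N / k := Nat.div_le_div_left hk5 hk
  have hfive := floor_div (y := N) (m := N) 5 (by norm_num) le_rfl (by linarith)
  have hkk := floor_div (y := N) (m := N) k hk le_rfl (by linarith)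
  have h200 : 200 ≤ N / 5 := by omega
  have h200' : (200 : ℝ) ≤ ((N / 5 : ℕ) : ℝ) := by exact_mod_cast h200
  have hkm : ((N / 5 : ℕ) : ℝ) ≤ ((N / k : ℕ) : ℝ) := by exact_mod_cast h5
  have hu := uu_bd (N / 5) (N / k) (by omega) h5
  have hs := sq_diff (a := ((N / k : ℕ) : ℝ)) (b := N / k) (by linarith) hkk.1
  have hNk : (N : ℝ) / k ≤ N := div_le_self (by linarith) hk'
  have lN : 0 ≤ Real.log N := Real.log_nonneg (by linarith)
  push_cast at hfive
  -- bound of log m / m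
  have gen : ∀ m : ℕ, ((N / 5 : ℕ) : ℝ) ≤ m → (m : ℝ) ≤ N → Real.log m / m ≤ 5.1 * Real.log N / N := by
    intro m h1 h2
    have e1 : Real.log m ≤ Real.log N := Real.log_le_log (by linarith) h2
    have e0 : 0 ≤ Real.log m := Real.log_nonneg (by linarith)
    rw [div_le_div_iff₀ (by linarith) (by linarith)]
    have : (N : ℝ) ≤ 5.1 * m := by linarith
    calc Real.log m * N ≤ Real.log N * (5.1 * m) := by
          apply mul_le_mul e1 this (by linarith) lN
      _ = _ := by ring
  have g1 := gen (N / 5) le_rfl (by linarith)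
  have g2 := gen (N / k) hkm (by linarith [hkk.1])
  have hpos : 0 ≤ Real.log ((N / k : ℕ) : ℝ) / ((N / k : ℕ) : ℝ) :=
    div_nonneg (Real.log_nonneg (by linarith)) (by linarith)
  have hpos2 : 0 ≤ Real.log (N / k : ℝ) / (N / k : ℝ) :=
    div_nonneg (Real.log_nonneg (by linarith [hkk.1])) (by linarith [hkk.1])
  have hs2 := hs.2
  have hs1 := hs.1
  have z1 : ((N : ℝ) / k - (N / k : ℕ)) * (Real.log ((N / k : ℕ) : ℝ) / ((N / k : ℕ) : ℝ)) ≤ 1 * (Real.log ((N / k : ℕ) : ℝ) / ((N / k : ℕ) : ℝ)) :=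
    mul_le_mul_of_nonneg_right (by linarith [hkk.2]) hpos
  have z2 : 0 ≤ ((N : ℝ) / k - (N / k : ℕ)) * (Real.log (N / k : ℝ) / (N / k : ℝ)) :=
    mul_nonneg (by linarith [hkk.1]) hpos2
  have hue : LL (N / k) = uu (N / k) + Real.log ((N / k : ℕ) : ℝ) ^ 2 / 2 := by rw [uu]; ring
  have e102 : 10.2 * Real.log N / N = 5.1 * Real.log N / N + 5.1 * Real.log N / N := by ring
  rw [hue, e102]
  constructor
  · linarith [hu.2]
  · linarith [hu.1]

noncomputable def C0 : ℝ := (-(Real.log 2 ^ 2 / 4) - Real.log 3 ^ 2 / 6 - Real.log 5 ^ 2 / 12)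
  - (Real.log 2 / 2 + Real.log 3 / 3 + (1 / 6 + bb / 5) * Real.log 5) - bb / 5

lemma VV_bd (N : ℕ) (hN : 1000 ≤ N) :
    N * (Real.log N + C0) - 15 * Real.log N - 0.13 * ps (N / 5) ≤ VV N ∧
    VV N ≤ N * (Real.log N + C0) + 15 * Real.log N + 0.03 * ps (N / 5) := by
  have hE := sumEE_bd N
  have l1 := LL_div_bd N 1 (by norm_num) (by norm_num) hN
  have l2 := LL_div_bd N 2 (by norm_num) (by norm_num) hN
  have l3 := LL_div_bd N 3 (by norm_num) (by norm_num) hN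
  have l5 := LL_div_bd N 5 (by norm_num) (by norm_num) hN
  have t1 := TT_div_bd N 1 (by norm_num) (by omega)
  have t2 := TT_div_bd N 2 (by norm_num) (by omega)
  have t3 := TT_div_bd N 3 (by norm_num) (by omega)
  have t5 := TT_div_bd N 5 (by norm_num) (by omega)
  rw [Nat.div_one] at t1 l1
  have hN' : (1000 : ℝ) ≤ N := by exact_mod_cast hN
  have hN0 : (N : ℝ) ≠ 0 := by positivity
  have lN : 3 ≤ Real.log N := by
    have : Real.log (2 ^ 9) ≤ Real.log N := Real.log_le_log (by norm_num) (by linarith)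
    rw [Real.log_pow] at this
    push_cast at this
    linarith [Real.log_two_gt_d9]
  rw [VV_eq]
  set S := ∑ n ∈ Ioc 0 N, ArithmeticFunction.vonMangoldt n * EE ((N : ℝ) / n) (N / n) with hS
  clear_value S
  have b1 := bb_gt
  have b2 := bb_lt
  set r1 := LL N - uu (N / 5) - Real.log (N / (1 : ℕ) : ℝ) ^ 2 / 2 with hr1
  set r2 := LL (N / 2) - uu (N / 5) - Real.log (N / (2 : ℕ) : ℝ) ^ 2 / 2 with hr2
  set r3 := LL (N / 3) - uu (N / 5) - Real.log (N / (3 : ℕ) : ℝ) ^ 2 / 2 with hr3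
  set r5 := LL (N / 5) - uu (N / 5) - Real.log (N / (5 : ℕ) : ℝ) ^ 2 / 2 with hr5
  set s1 := TT N - ff (N / (1 : ℕ) : ℝ) with hs1
  set s2 := TT (N / 2) - ff (N / (2 : ℕ) : ℝ) with hs2
  set s3 := TT (N / 3) - ff (N / (3 : ℕ) : ℝ) with hs3
  set s5 := TT (N / 5) - ff (N / (5 : ℕ) : ℝ) with hs5
  have key : N * (LL N - LL (N / 2) / 2 - LL (N / 3) / 3 - LL (N / 5) / 6)
      - TT N + TT (N / 2) + TT (N / 3) + (5 / 6 + bb) * TT (N / 5)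
      = N * (Real.log N + C0) + (11 / 6 + bb) + N * (r1 - r2 / 2 - r3 / 3 - r5 / 6)
        + (-s1 + s2 + s3 + (5 / 6 + bb) * s5) := by
    have hl : Real.log 2 / 2 + Real.log 3 / 3 + Real.log 5 / 6 = 1 - bb / 5 := by rw [bb]; ring
    have hl3 : Real.log 3 = 3 * (1 - bb / 5 - Real.log 2 / 2 - Real.log 5 / 6) := by linarith
    rw [hr1, hr2, hr3, hr5, hs1, hs2, hs3, hs5]
    push_cast
    rw [ff, ff, ff, ff, Real.log_div hN0 (by norm_num), Real.log_div hN0 (by norm_num),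
      Real.log_div hN0 (by norm_num), Real.log_div hN0 (by norm_num), Real.log_one, C0]
    linear_combination (N : ℝ) * Real.log N * hl
  rw [key]
  have hd : (N : ℝ) * (10.2 * Real.log N / N) = 10.2 * Real.log N := by field_simp
  have m1 := mul_le_mul_of_nonneg_left l1.1 (by linarith : (0:ℝ) ≤ N)
  have m2 := mul_le_mul_of_nonneg_left l2.1 (by linarith : (0:ℝ) ≤ N)
  have m3 := mul_le_mul_of_nonneg_left l3.1 (by linarith : (0:ℝ) ≤ N)
  have m5 := mul_le_mul_of_nonneg_left l5.1 (by linarith : (0:ℝ) ≤ N)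
  have n1 := mul_le_mul_of_nonneg_left l1.2 (by linarith : (0:ℝ) ≤ N)
  have n2 := mul_le_mul_of_nonneg_left l2.2 (by linarith : (0:ℝ) ≤ N)
  have n3 := mul_le_mul_of_nonneg_left l3.2 (by linarith : (0:ℝ) ≤ N)
  have n5 := mul_le_mul_of_nonneg_left l5.2 (by linarith : (0:ℝ) ≤ N)
  rw [mul_neg, hd] at m1 m2 m3 m5
  rw [mul_zero] at n1 n2 n3 n5
  have q1 : (5 / 6 + bb) * s5 ≤ (5 / 6 + bb) * Real.log N := by
    apply mul_le_mul_of_nonneg_left (by rw [hs5]; linarith [t5.2]) (by linarith)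
  have q2 : (5 / 6 + bb) * (-Real.log N) ≤ (5 / 6 + bb) * s5 := by
    apply mul_le_mul_of_nonneg_left (by rw [hs5]; linarith [t5.1]) (by linarith)
  have q3 : bb * Real.log N ≤ 0.1 * Real.log N := mul_le_mul_of_nonneg_right (by linarith) (by linarith)
  have p1 : s1 ≤ Real.log N := by rw [hs1]; linarith [t1.2]
  have p2 : -Real.log N ≤ s1 := by rw [hs1]; linarith [t1.1]
  have p3 : s2 ≤ Real.log N := by rw [hs2]; linarith [t2.2]
  have p4 : -Real.log N ≤ s2 := by rw [hs2]; linarith [t2.1]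
  have p5 : s3 ≤ Real.log N := by rw [hs3]; linarith [t3.2]
  have p6 : -Real.log N ≤ s3 := by rw [hs3]; linarith [t3.1]
  clear_value r1 r2 r3 r5 s1 s2 s3 s5
  constructor <;> linarith [hE.1, hE.2]

end RobinAux


namespace RobinAux
open ArithmeticFunction (vonMangoldt)

noncomputable def N1 (n : ℕ) : ℝ := ∑ k ∈ Ioc 0 n, vonMangoldt k / (k * Real.log k)

lemma N1_succ (n : ℕ) : N1 (n + 1) = N1 n + vonMangoldt (n + 1) / ((n + 1) * Real.log (n + 1)) := by
  rw [N1, N1, Finset.sum_Ioc_succ_top (Nat.zero_le n)]; push_cast; rfl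

lemma ps_succ (n : ℕ) : ps (n + 1) = ps n + vonMangoldt (n + 1) := by
  rw [ps, ps, Finset.sum_Ioc_succ_top (Nat.zero_le n)]

noncomputable def WW (n : ℕ) : ℝ := VV n / n

lemma WW_succ (n : ℕ) (hn : 0 < n) : WW (n + 1) = WW n + ps n * (1 / n - 1 / (n + 1)) := by
  have hn' : (0 : ℝ) < n := by exact_mod_cast hn
  have gen : ∀ k : ℕ, 0 < k → WW k = ∑ j ∈ Ioc 0 k, vonMangoldt j * (1 / j - 1 / k) := by
    intro k hk
    have hk' : (0 : ℝ) < k := by exact_mod_cast hk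
    rw [WW, VV, Finset.sum_div]
    apply Finset.sum_congr rfl
    intro j hj
    rw [mem_Ioc] at hj
    have hj' : (0 : ℝ) < j := by exact_mod_cast hj.1
    field_simp
  rw [gen (n + 1) (by omega), gen n hn, Finset.sum_Ioc_succ_top (Nat.zero_le n), sub_self, mul_zero, add_zero, ps,
    Finset.sum_mul, ← Finset.sum_add_distrib]
  apply Finset.sum_congr rfl
  intro j _
  push_cast
  ring

lemma deriv_g (A P w a c t : ℝ) (ht : 1 < t) :
    HasDerivAt (fun t : ℝ => A - P * (t⁻¹ * (Real.log t)⁻¹) - (w + P * (a - t⁻¹)) * ((Real.log t)⁻¹ + (Real.log t)⁻¹ ^ 2)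
      - (Real.log (Real.log t) - (2 + c) * (Real.log t)⁻¹ - c * (Real.log t)⁻¹ ^ 2))
      ((w + P * (a - t⁻¹) - Real.log t - c) * (t⁻¹ * ((Real.log t)⁻¹ ^ 2 + 2 * (Real.log t)⁻¹ ^ 3))) t := by
  have ht0 : t ≠ 0 := by linarith
  have hl : 0 < Real.log t := Real.log_pos ht
  have h1 : HasDerivAt (fun t : ℝ => t⁻¹) (-(t ^ 2)⁻¹) t := hasDerivAt_inv ht0
  have h2 : HasDerivAt Real.log t⁻¹ t := Real.hasDerivAt_log ht0
  have h3 := h2.inv hl.ne'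
  have h4 := h2.log hl.ne'
  have h5 := h3.pow 2
  have h6 := ((((h1.mul h3).const_mul P).const_sub A).sub ((((h1.const_sub a).const_mul P).const_add w).mul (h3.add h5))).sub
    ((h4.sub (h3.const_mul (2 + c))).sub (h5.const_mul c))
  refine h6.congr_deriv ?_
  simp only [Pi.inv_apply, Pi.add_apply, Pi.pow_apply, Nat.add_one_sub_one, pow_one, Nat.cast_ofNat]
  field_simp
  ring

noncomputable def Sg (c : ℝ) (n : ℕ) : ℝ :=
  N1 n - ps n * ((n : ℝ)⁻¹ * (Real.log n)⁻¹) - WW n * ((Real.log n)⁻¹ + (Real.log n)⁻¹ ^ 2)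
      - (Real.log (Real.log n) - (2 + c) * (Real.log n)⁻¹ - c * (Real.log n)⁻¹ ^ 2)

lemma Sg_step (c : ℝ) (n : ℕ) (hn : 2 ≤ n) (h : Real.log n + 1 / n + c ≤ WW n) :
    Sg c n ≤ Sg c (n + 1) := by
  have hn' : (2 : ℝ) ≤ n := by exact_mod_cast hn
  set g := (fun t : ℝ => N1 n - ps n * (t⁻¹ * (Real.log t)⁻¹) - (WW n + ps n * ((n : ℝ)⁻¹ - t⁻¹)) * ((Real.log t)⁻¹ + (Real.log t)⁻¹ ^ 2)
      - (Real.log (Real.log t) - (2 + c) * (Real.log t)⁻¹ - c * (Real.log t)⁻¹ ^ 2)) with hg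
  have hlt : (n : ℝ) < n + 1 := by linarith
  have hd : ∀ t : ℝ, 1 < t → HasDerivAt g ((WW n + ps n * ((n : ℝ)⁻¹ - t⁻¹) - Real.log t - c) * (t⁻¹ * ((Real.log t)⁻¹ ^ 2 + 2 * (Real.log t)⁻¹ ^ 3))) t :=
    fun t ht => deriv_g _ _ _ _ _ t ht
  obtain ⟨t, ht, he⟩ := exists_hasDerivAt_eq_slope g _ hlt
    (fun x hx => (hd x (by linarith [hx.1])).continuousAt.continuousWithinAt)
    (fun x hx => hd x (by linarith [hx.1]))
  have e1 : Sg c n = g n := by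
    rw [Sg, hg]; simp
  have e2 : Sg c (n + 1) = g (n + 1) := by
    have hL : 0 < Real.log (n + 1) := Real.log_pos (by linarith)
    rw [Sg, hg]
    simp only
    rw [N1_succ, ps_succ, WW_succ n (by omega)]
    push_cast
    have : vonMangoldt (n + 1) / (((n : ℝ) + 1) * Real.log (n + 1)) = vonMangoldt (n + 1) * (((n : ℝ) + 1)⁻¹ * (Real.log (n + 1))⁻¹) := by
      rw [div_eq_mul_inv, mul_inv]
    rw [this, one_div, one_div]
    ring
  rw [e1, e2]
  have e3 : ((n : ℝ) + 1 - n) = 1 := by ring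
  rw [e3, div_one] at he
  have hpos : 0 ≤ (WW n + ps n * ((n : ℝ)⁻¹ - t⁻¹) - Real.log t - c) * (t⁻¹ * ((Real.log t)⁻¹ ^ 2 + 2 * (Real.log t)⁻¹ ^ 3)) := by
    have htn : (n : ℝ) < t := ht.1
    have hL : 0 < Real.log t := Real.log_pos (by linarith)
    have ht0 : 0 < t := by linarith
    apply mul_nonneg _ (by positivity)
    have i1 : t⁻¹ ≤ (n : ℝ)⁻¹ := by
      apply inv_anti₀ (by linarith) htn.le
    have i2 : 0 ≤ ps n * ((n : ℝ)⁻¹ - t⁻¹) := mul_nonneg (ps_nonneg n) (by linarith)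
    have i3 : Real.log t ≤ Real.log n + 1 / n := by
      have := Real.log_le_sub_one_of_pos (x := t / n) (by positivity)
      rw [Real.log_div (by linarith) (by linarith)] at this
      have h4 : t / n - 1 ≤ 1 / n := by
        rw [div_sub_one (by linarith)]
        apply div_le_div_of_nonneg_right _ (by linarith)
        linarith [ht.2]
      linarith
    linarith
  linarith

lemma Sg_mono (c : ℝ) (X : ℕ) (hX : 2 ≤ X) (h : ∀ n, X ≤ n → Real.log n + 1 / n + c ≤ WW n)
    (x y : ℕ) (hx : X ≤ x) (hxy : x ≤ y) : Sg c x ≤ Sg c y := by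
  induction y, hxy using Nat.le_induction with
  | base => exact le_rfl
  | succ k hk ih => exact ih.trans (Sg_step c k (by omega) (h k (by omega)))

lemma Sg_limit (hγ : ∀ ε > (0 : ℝ), ∀ m0 : ℕ, ∃ m ≥ m0, N1 ⌊Real.exp m⌋₊ < HH m + ε)
    (c : ℝ) (X : ℕ) (hX : 2 ≤ X) (h : ∀ n, X ≤ n → Real.log n + 1 / n + c ≤ WW n)
    (x : ℕ) (hx : X ≤ x) : Sg c x ≤ Real.eulerMascheroniConstant - 1 := by
  apply le_of_forall_pos_le_add
  intro ε hε
  obtain ⟨q, hq⟩ := exists_nat_gt (6 / ε)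
  obtain ⟨m, hm, hN⟩ := hγ (ε / 2) (by positivity) (q + x + 3)
  set y := ⌊Real.exp m⌋₊ with hy
  have hm3 : (3 : ℝ) ≤ m := by exact_mod_cast (by omega : 3 ≤ m)
  have hxm : (x : ℝ) ≤ m := by exact_mod_cast (by omega : x ≤ m)
  have hqm : (q : ℝ) ≤ m - 1 := by
    have : ((q + 1 : ℕ) : ℝ) ≤ m := by exact_mod_cast (by omega : q + 1 ≤ m)
    push_cast at this; linarith
  have hmexp : (m : ℝ) + 1 ≤ Real.exp m := Real.add_one_le_exp _
  have hxy : x ≤ y := by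
    apply Nat.le_floor; linarith
  have hyle : (y : ℝ) ≤ Real.exp m := Nat.floor_le (Real.exp_pos _).le
  have hylt : Real.exp m < y + 1 := Nat.lt_floor_add_one _
  have hyexp : Real.exp (m - 1 : ℝ) ≤ y := by
    have e1 : Real.exp m = Real.exp (m - 1 : ℝ) * Real.exp 1 := by rw [← Real.exp_add]; ring_nf
    have e2 : (2 : ℝ) ≤ Real.exp 1 := by linarith [Real.exp_one_gt_d9]
    have e3 : 1 ≤ Real.exp (m - 1 : ℝ) := Real.one_le_exp (by linarith)
    nlinarith
  have hl1 : (m : ℝ) - 1 ≤ Real.log y := by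
    rw [Real.le_log_iff_exp_le (lt_of_lt_of_le (Real.exp_pos _) hyexp)]; exact hyexp
  refine (Sg_mono c X hX h x y hx hxy).trans ?_
  have hW := h y (hx.trans hxy)
  have hy0 : (0 : ℝ) < y := lt_of_lt_of_le (Real.exp_pos _) hyexp
  have hl0 : 0 < Real.log y := by linarith
  have hW2 : Real.log y + c ≤ WW y := by
    have : 0 < 1 / (y : ℝ) := by positivity
    linarith
  have hW3 := mul_le_mul_of_nonneg_right hW2 (by positivity : 0 ≤ (Real.log y)⁻¹ + (Real.log y)⁻¹ ^ 2)
  have e4 : (Real.log y + c) * ((Real.log y)⁻¹ + (Real.log y)⁻¹ ^ 2)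
     = 1 + (Real.log y)⁻¹ + c * (Real.log y)⁻¹ + c * (Real.log y)⁻¹ ^ 2 := by
    field_simp; ring
  have hP : 0 ≤ ps y * ((y : ℝ)⁻¹ * (Real.log y)⁻¹) := mul_nonneg (ps_nonneg y) (by positivity)
  have hH := HH_le (m := m) (by omega)
  have g1 : Real.log (m - 1 : ℝ) ≤ Real.log (Real.log y) := Real.log_le_log (by linarith) hl1
  have g2 : (Real.log y)⁻¹ ≤ ((m : ℝ) - 1)⁻¹ := inv_anti₀ (by linarith) hl1
  have g3 : Real.log m - Real.log (m - 1 : ℝ) ≤ ((m : ℝ) - 1)⁻¹ := by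
    have := Real.log_le_sub_one_of_pos (x := m / (m - 1 : ℝ)) (by apply div_pos <;> linarith)
    rw [Real.log_div (by linarith) (by linarith)] at this
    have h5 : (m : ℝ) / (m - 1) - 1 = ((m : ℝ) - 1)⁻¹ := by
      rw [div_sub_one (by linarith)]; simp
    linarith
  have g4 : 1 / (2 * (m : ℝ)) ≤ ((m : ℝ) - 1)⁻¹ := by
    rw [one_div]; apply inv_anti₀ (by linarith); linarith
  have g5 : 3 * ((m : ℝ) - 1)⁻¹ ≤ ε / 2 := by
    have : 6 / ε < m - 1 := by linarith
    rw [div_lt_iff₀ hε] at this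
    rw [← div_eq_mul_inv, div_le_iff₀ (by linarith)]
    linarith
  rw [Sg]
  linarith

lemma N1_le (hγ : ∀ ε > (0 : ℝ), ∀ m0 : ℕ, ∃ m ≥ m0, N1 ⌊Real.exp m⌋₊ < HH m + ε)
    (c1 c2 : ℝ) (X : ℕ) (hX : 2 ≤ X) (h : ∀ n, X ≤ n → Real.log n + c1 ≤ WW n)
    (x : ℕ) (hx : X ≤ x) (h2 : WW x ≤ Real.log x + c2) :
    N1 x ≤ Real.eulerMascheroniConstant + Real.log (Real.log x) +
      (ps x / x - 1 + (c2 - c1 + 1 / X) * (1 + 1 / Real.log x)) / Real.log x := by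
  have hX' : (2 : ℝ) ≤ X := by exact_mod_cast hX
  have hx' : (X : ℝ) ≤ x := by exact_mod_cast hx
  have hS := Sg_limit hγ (c1 - 1 / X) X hX (by
    intro n hn
    have hn' : (X : ℝ) ≤ n := by exact_mod_cast hn
    have : 1 / (n : ℝ) ≤ 1 / X := one_div_le_one_div_of_le (by linarith) hn'
    linarith [h n hn]) x hx
  have hl : 0 < Real.log x := Real.log_pos (by linarith)
  have h3 := mul_le_mul_of_nonneg_right h2 (by positivity : 0 ≤ (Real.log x)⁻¹ + (Real.log x)⁻¹ ^ 2)
  have e4 : (Real.log x + c2) * ((Real.log x)⁻¹ + (Real.log x)⁻¹ ^ 2)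
     = 1 + (Real.log x)⁻¹ + c2 * (Real.log x)⁻¹ + c2 * (Real.log x)⁻¹ ^ 2 := by
    field_simp; ring
  rw [Sg] at hS
  have e5 : (ps x / x - 1 + (c2 - c1 + 1 / X) * (1 + 1 / Real.log x)) / Real.log x
     = ps x * ((x : ℝ)⁻¹ * (Real.log x)⁻¹) - (Real.log x)⁻¹ + (c2 - c1 + 1 / X) * ((Real.log x)⁻¹ + (Real.log x)⁻¹ ^ 2) := by
    field_simp
  rw [e5]
  linarith

end RobinAux


namespace RobinAux
open ArithmeticFunction (vonMangoldt)

lemma log_zeta_le {δ : ℝ} (hδ : 0 < δ) :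
    Real.log (riemannZeta ((1 + δ : ℝ) : ℂ)).re ≤ Real.log (1 + 1 / δ) := by
  have hs : 1 < 1 + δ := by linarith
  have hpos := riemannZeta_re_pos_of_one_lt hs
  apply Real.log_le_log hpos
  have h1 : riemannZeta ((1 + δ : ℝ) : ℂ) = ((∑' n : ℕ, 1 / (n + 1 : ℝ) ^ (1 + δ) : ℝ) : ℂ) := by
    rw [zeta_eq_tsum_one_div_nat_add_one_cpow (by simpa using hs), Complex.ofReal_tsum]
    congr 1 with n
    rw [Complex.ofReal_div, Complex.ofReal_cpow (by positivity)]
    norm_cast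
  rw [h1, Complex.ofReal_re]
  have h2 := ZetaAsymptotics.zeta_limit_aux1 hs
  have h3 : 0 ≤ ZetaAsymptotics.termTSum (1 + δ) := tsum_nonneg (fun n => ZetaAsymptotics.term_nonneg _ _)
  have h4 : 1 + δ - 1 = δ := by ring
  rw [h4] at h2
  nlinarith

noncomputable def tz (δ : ℝ) (n : ℕ) : ℝ := vonMangoldt n / ((n : ℝ) ^ (1 + δ) * Real.log n)

lemma tz_nonneg (δ : ℝ) (n : ℕ) : 0 ≤ tz δ n := by
  rw [tz]
  apply div_nonneg ArithmeticFunction.vonMangoldt_nonneg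
  apply mul_nonneg (Real.rpow_nonneg (by positivity) _) (Real.log_natCast_nonneg n)

lemma tz_summable {δ : ℝ} (hδ : 0 < δ) : Summable (tz δ) := by
  apply Summable.of_nonneg_of_le (tz_nonneg δ) _ (Real.summable_one_div_nat_rpow.2 (by linarith : 1 < 1 + δ))
  intro n
  rw [tz]
  by_cases h : n ≤ 1
  · have : vonMangoldt n = 0 := by interval_cases n <;> simp
    rw [this, zero_div]; positivity
  · have hn : (1 : ℝ) < n := by exact_mod_cast (by omega : 1 < n)
    have hl := Real.log_pos hn
    have hp : 0 < (n : ℝ) ^ (1 + δ) := Real.rpow_pos_of_pos (by linarith) _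
    rw [div_le_div_iff₀ (by positivity) hp, one_mul]
    have := mul_le_mul_of_nonneg_right (ArithmeticFunction.vonMangoldt_le_log (n := n)) hp.le
    linarith

lemma sum_tz_le {δ : ℝ} (hδ : 0 < δ) (N : ℕ) :
    ∑ n ∈ Ioc 0 N, tz δ n ≤ Real.log (1 + 1 / δ) := by
  refine le_trans ?_ (log_zeta_le hδ)
  rw [log_riemannZeta_eq (by linarith : 1 < 1 + δ)]
  exact (tz_summable hδ).sum_le_tsum _ (fun n _ => tz_nonneg δ n)

noncomputable def AA (m : ℕ) : ℝ := N1 ⌊Real.exp m⌋₊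

lemma AA_zero : AA 0 = 0 := by
  simp [AA, N1]

lemma N1_nonneg (n : ℕ) : 0 ≤ N1 n := by
  apply Finset.sum_nonneg
  intro k _
  exact div_nonneg ArithmeticFunction.vonMangoldt_nonneg (mul_nonneg (by positivity) (Real.log_natCast_nonneg k))

lemma group_le {δ : ℝ} (hδ : 0 < δ) (M : ℕ) :
    ∑ i ∈ range M, (AA (i + 1) - AA i) * Real.exp (-δ) ^ (i + 1) ≤ ∑ n ∈ Ioc 0 ⌊Real.exp M⌋₊, tz δ n := by
  induction M with
  | zero => simp [tz]
  | succ k ih =>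
    have hle : ⌊Real.exp k⌋₊ ≤ ⌊Real.exp (k + 1 : ℕ)⌋₊ := by
      apply Nat.floor_mono
      apply Real.exp_le_exp.2; push_cast; linarith
    rw [Finset.sum_range_succ, ← Finset.sum_Ioc_consecutive _ (Nat.zero_le _) hle]
    apply add_le_add ih
    have hA : AA (k + 1) - AA k = ∑ n ∈ Ioc ⌊Real.exp k⌋₊ ⌊Real.exp (k + 1 : ℕ)⌋₊, vonMangoldt n / (n * Real.log n) := by
      rw [AA, AA, N1, N1, ← Finset.sum_Ioc_consecutive _ (Nat.zero_le _) hle]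
      ring
    rw [hA, Finset.sum_mul]
    apply Finset.sum_le_sum
    intro n hn
    rw [mem_Ioc] at hn
    have hk1 : 1 ≤ ⌊Real.exp k⌋₊ := by
      apply Nat.le_floor; simp
    have hn1 : (1 : ℝ) < n := by exact_mod_cast lt_of_le_of_lt hk1 hn.1
    have hne : (n : ℝ) ≤ Real.exp (k + 1 : ℕ) := by
      have : (n : ℝ) ≤ (⌊Real.exp (k + 1 : ℕ)⌋₊ : ℝ) := by exact_mod_cast hn.2
      exact this.trans (Nat.floor_le (Real.exp_pos _).le)
    have hl := Real.log_pos hn1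
    have hn0 : (0 : ℝ) < n := by linarith
    have hpw : Real.exp (-δ) ^ (k + 1) ≤ (n : ℝ) ^ (-δ) := by
      rw [← Real.exp_nat_mul, Real.rpow_def_of_pos hn0]
      apply Real.exp_le_exp.2
      have := Real.log_le_log hn0 hne
      rw [Real.log_exp] at this
      nlinarith
    have e : tz δ n = vonMangoldt n / (n * Real.log n) * (n : ℝ) ^ (-δ) := by
      rw [tz, Real.rpow_add hn0, Real.rpow_one, Real.rpow_neg hn0.le]
      field_simp
    rw [e]
    apply mul_le_mul_of_nonneg_left hpw
    exact div_nonneg ArithmeticFunction.vonMangoldt_nonneg (by positivity)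

lemma abel_id (B : ℕ → ℝ) (hB : B 0 = 0) (z : ℝ) (M : ℕ) :
    ∑ i ∈ range M, (B (i + 1) - B i) * z ^ (i + 1) = B M * z ^ M + (1 - z) * ∑ i ∈ range M, B i * z ^ i := by
  induction M with
  | zero => simp [hB]
  | succ k ih => rw [Finset.sum_range_succ, Finset.sum_range_succ, ih]; ring

lemma abel_low (B : ℕ → ℝ) (z ε K : ℝ) (hz : 0 < z) (hz1 : z < 1) (m0 : ℕ) (hK : 0 ≤ K)
    (h1 : ∀ i, m0 ≤ i → ε ≤ B i) (h2 : ∀ i, i < m0 → -K ≤ B i) (M : ℕ) (hM : m0 ≤ M) :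
    ε * (z ^ m0 - z ^ M) - K * m0 * (1 - z) ≤ (1 - z) * ∑ i ∈ range M, B i * z ^ i := by
  induction M, hM using Nat.le_induction with
  | base =>
    have : ∑ i ∈ range m0, (-K) ≤ ∑ i ∈ range m0, B i * z ^ i := by
      apply Finset.sum_le_sum
      intro i hi
      have hzi : z ^ i ≤ 1 := pow_le_one₀ hz.le hz1.le
      have hzi0 : 0 < z ^ i := by positivity
      have := h2 i (mem_range.1 hi)
      nlinarith
    rw [Finset.sum_const, card_range, nsmul_eq_mul] at this
    nlinarith
  | succ k hk ih =>
    rw [Finset.sum_range_succ]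
    have hb := h1 k hk
    have hzi0 : 0 < (1 - z) * z ^ k := mul_pos (by linarith) (by positivity)
    have := mul_le_mul_of_nonneg_left hb hzi0.le
    have e : z ^ (k + 1) = z ^ k - (1 - z) * z ^ k := by ring
    rw [e]
    linarith

lemma gamma_freq : ∀ ε > (0 : ℝ), ∀ m0 : ℕ, ∃ m ≥ m0, N1 ⌊Real.exp m⌋₊ < HH m + ε := by
  intro ε hε m0
  by_contra! hcon
  set K := HH m0 with hKdef
  have HH_mono : Monotone HH := by
    apply monotone_nat_of_le_succ
    intro n
    rw [HH_succ]
    have : 0 < 1 / ((n : ℝ) + 1) := by positivity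
    linarith
  have hK : 0 ≤ K := by
    have := HH_mono (Nat.zero_le m0)
    rwa [HH_zero] at this
  set B : ℕ → ℝ := fun m => AA m - HH m with hBdef
  have hB0 : B 0 = 0 := by simp [hBdef, AA_zero, HH_zero]
  have hB1 : ∀ i, m0 ≤ i → ε ≤ B i := by
    intro i hi
    have := hcon i hi
    simp only [hBdef, AA]; linarith
  have hB2 : ∀ i, i < m0 → -K ≤ B i := by
    intro i hi
    have h1 := HH_mono hi.le
    have h2 : 0 ≤ AA i := N1_nonneg _
    simp only [hBdef]; linarith
  have main : ∀ δ : ℝ, 0 < δ → ε ≤ δ * (1 + ε * m0 + K * m0) := by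
    intro δ hδ
    set z := Real.exp (-δ) with hz
    have hz0 : 0 < z := Real.exp_pos _
    have hz1 : z < 1 := by rw [hz, Real.exp_lt_one_iff]; linarith
    have hz2 : 1 - z ≤ δ := by
      have := Real.add_one_le_exp (-δ); linarith
    have hfin : ∀ M, m0 ≤ M → ∑ i ∈ range M, z ^ (i + 1) / ((i : ℝ) + 1) ≤
        Real.log (1 + 1 / δ) - ε * z ^ m0 + K * m0 * (1 - z) := by
      intro M hM
      have h1 := (group_le hδ M).trans (sum_tz_le hδ _)
      have h2 := abel_id B hB0 z M
      have h3 := abel_low B z ε K hz0 hz1 m0 hK hB1 hB2 M hM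
      have h4 : ∑ i ∈ range M, (AA (i + 1) - AA i) * z ^ (i + 1)
          = ∑ i ∈ range M, (B (i + 1) - B i) * z ^ (i + 1) + ∑ i ∈ range M, z ^ (i + 1) / ((i : ℝ) + 1) := by
        rw [← Finset.sum_add_distrib]
        apply Finset.sum_congr rfl
        intro i _
        simp only [hBdef]
        rw [HH_succ]; ring
      have h5 := mul_le_mul_of_nonneg_right (hB1 M hM) (by positivity : 0 ≤ z ^ M)
      rw [← hz] at h1
      linarith
    have hser := Real.hasSum_pow_div_log_of_abs_lt_one (x := z) (by rw [abs_of_pos hz0]; exact hz1)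
    have hlim := hser.tendsto_sum_nat
    have hle : -Real.log (1 - z) ≤ Real.log (1 + 1 / δ) - ε * z ^ m0 + K * m0 * (1 - z) := by
      apply le_of_tendsto hlim
      filter_upwards [Filter.eventually_ge_atTop m0] with M hM
      exact hfin M hM
    have hlog1 : Real.log (1 - z) ≤ Real.log δ := Real.log_le_log (by linarith) hz2
    have hlog2 : Real.log (1 + 1 / δ) = Real.log (1 + δ) - Real.log δ := by
      rw [← Real.log_div (by positivity) hδ.ne']
      congr 1; field_simp; ring
    have hlog3 : Real.log (1 + δ) ≤ δ := by
      have := Real.log_le_sub_one_of_pos (x := 1 + δ) (by linarith); linarith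
    have hzm : 1 - m0 * δ ≤ z ^ m0 := by
      rw [hz, ← Real.exp_nat_mul]
      have := Real.add_one_le_exp ((m0 : ℝ) * -δ)
      linarith
    have e1 := mul_le_mul_of_nonneg_left hzm hε.le
    have e2 := mul_le_mul_of_nonneg_left hz2 (by positivity : 0 ≤ K * m0)
    nlinarith
  have hD : 0 < 1 + ε * m0 + K * m0 := by positivity
  have := main (ε / (2 * (1 + ε * m0 + K * m0))) (by positivity)
  have e : ε / (2 * (1 + ε * m0 + K * m0)) * (1 + ε * m0 + K * m0) = ε / 2 := by field_simp
  rw [e] at this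
  linarith

end RobinAux


namespace RobinAux
open ArithmeticFunction (vonMangoldt)

lemma sum_pp_le (f : ℕ → ℝ) (hf : ∀ n, 0 ≤ f n) (x : ℕ) :
    ∑ p ∈ (Ioc 0 x).filter Nat.Prime, ∑ j ∈ Icc 1 (Nat.log p x), f (p ^ j) ≤ ∑ n ∈ Ioc 0 x, f n := by
  rw [Finset.sum_sigma' ((Ioc 0 x).filter Nat.Prime) (fun p => Icc 1 (Nat.log p x)) (fun p j => f (p ^ j))]
  rw [← Finset.sum_image (f := f) (g := fun a : (Σ _ : ℕ, ℕ) => a.1 ^ a.2)]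
  · apply Finset.sum_le_sum_of_subset_of_nonneg
    · intro n hn
      simp only [mem_image, mem_sigma, mem_filter, mem_Ioc, mem_Icc] at *
      obtain ⟨⟨p, j⟩, ⟨⟨⟨h1, h2⟩, hp⟩, h3, h4⟩, rfl⟩ := hn
      exact ⟨pow_pos h1 _, Nat.pow_le_of_le_log (by omega) h4⟩
    · intro n _ _
      exact hf n
  · rintro ⟨p, j⟩ h1 ⟨q, k⟩ h2 h
    simp only [coe_sigma, Set.mem_sigma_iff, mem_coe, mem_filter, mem_Icc] at h1 h2
    have h : p ^ j = q ^ k := h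
    have hj : j ≠ 0 := by have := h1.2.1; omega
    have hk : k ≠ 0 := by have := h2.2.1; omega
    have := h1.1.2.pow_inj' h2.1.2 hj hk h
    obtain ⟨rfl, rfl⟩ := this
    rfl

lemma log_tail {u : ℝ} (hu : 0 < u) (hu1 : u < 1) (J : ℕ) :
    -Real.log (1 - u) ≤ ∑ j ∈ Icc 1 J, u ^ j / j + u ^ (J + 1) / ((J + 1) * (1 - u)) := by
  have hser := Real.hasSum_pow_div_log_of_abs_lt_one (x := u) (by rw [abs_of_pos hu]; exact hu1)
  have h1 := hser.summable.sum_add_tsum_nat_add J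
  rw [hser.tsum_eq] at h1
  rw [← h1]
  have h2 : ∑ i ∈ range J, u ^ (i + 1) / ((i : ℝ) + 1) = ∑ j ∈ Icc 1 J, u ^ j / j := by
    clear h1
    induction J with
    | zero => simp
    | succ J ih =>
      rw [Finset.sum_range_succ, Finset.sum_Icc_succ_top (by omega), ih]
      push_cast
      rfl
  rw [h2]
  gcongr
  have hg := (hasSum_geometric_of_lt_one hu.le hu1).mul_left (u ^ (J + 1) / (J + 1))
  have hs := ((summable_nat_add_iff J).2 hser.summable).hasSum
  have := hasSum_le (fun i => ?_) hs hg
  · refine this.trans (le_of_eq ?_)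
    rw [div_mul_eq_div_div, div_eq_mul_inv (u ^ (J + 1) / (J + 1))]
  · have e : u ^ (J + 1) / ((J : ℝ) + 1) * u ^ i = u ^ (i + J + 1) / (J + 1) := by
      rw [show i + J + 1 = (J + 1) + i by ring, pow_add u (J + 1) i]; ring
    rw [e]
    apply div_le_div_of_nonneg_left (by positivity) (by positivity)
    push_cast
    have : (0 : ℝ) ≤ i := by positivity
    linarith

noncomputable def MM (x : ℕ) : ℝ := ∑ p ∈ (Ioc 0 x).filter Nat.Prime, -Real.log (1 - 1 / (p : ℝ))

lemma N1_ge (x : ℕ) :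
    ∑ p ∈ (Ioc 0 x).filter Nat.Prime, ∑ j ∈ Icc 1 (Nat.log p x), (1 / (p : ℝ)) ^ j / j ≤ N1 x := by
  refine le_trans (le_of_eq ?_) (sum_pp_le (fun n => vonMangoldt n / (n * Real.log n)) (fun n =>
    div_nonneg ArithmeticFunction.vonMangoldt_nonneg (mul_nonneg (by positivity) (Real.log_natCast_nonneg n))) x)
  apply Finset.sum_congr rfl
  intro p hp
  rw [mem_filter] at hp
  apply Finset.sum_congr rfl
  intro j hj
  rw [mem_Icc] at hj
  have hp1 : (1 : ℝ) < p := by exact_mod_cast hp.2.one_lt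
  have hl := Real.log_pos hp1
  have hj' : (0 : ℝ) < j := by exact_mod_cast (by omega : 0 < j)
  rw [ArithmeticFunction.vonMangoldt_apply_pow (by omega), ArithmeticFunction.vonMangoldt_apply_prime hp.2]
  push_cast
  rw [Real.log_pow, one_div, inv_pow]
  field_simp

lemma MM_le (x : ℕ) (hx : 4 ≤ x) : MM x ≤ N1 x + 7 / (6 * (Nat.sqrt x : ℝ)) := by
  set s := Nat.sqrt x with hs
  have hs2 : 2 ≤ s := Nat.le_sqrt'.2 (by omega)
  have hs2' : (2 : ℝ) ≤ s := by exact_mod_cast hs2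
  have hsx : s * s ≤ x := Nat.sqrt_le x
  have hsx' : (s : ℝ) * s ≤ x := by exact_mod_cast hsx
  have hsle : s ≤ x := Nat.sqrt_le_self x
  have hx0 : (4 : ℝ) ≤ x := by exact_mod_cast hx
  -- per prime bound
  have per : ∀ p ∈ (Ioc 0 x).filter Nat.Prime, -Real.log (1 - 1 / (p : ℝ)) ≤
      ∑ j ∈ Icc 1 (Nat.log p x), (1 / (p : ℝ)) ^ j / j +
        (if p ≤ s then 2 / (3 * (x : ℝ)) else 1 / 2 * (1 / ((p : ℝ) - 1) - 1 / p)) := by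
    intro p hp
    rw [mem_filter, mem_Ioc] at hp
    have hp2 := hp.2.two_le
    have hp2' : (2 : ℝ) ≤ p := by exact_mod_cast hp2
    have hu : 0 < 1 / (p : ℝ) := by positivity
    have hu1 : 1 / (p : ℝ) ≤ 1 / 2 := one_div_le_one_div_of_le (by norm_num) hp2'
    refine (log_tail hu (by linarith) (Nat.log p x)).trans ?_
    gcongr
    split_ifs with h
    · have hJ : 2 ≤ Nat.log p x := by
        apply Nat.le_log_of_pow_le hp.2.one_lt
        calc p ^ 2 = p * p := by ring
          _ ≤ s * s := Nat.mul_le_mul h h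
          _ ≤ x := hsx
      have hlt : x < p ^ (Nat.log p x + 1) := Nat.lt_pow_succ_log_self hp.2.one_lt x
      have hlt' : (x : ℝ) < (p : ℝ) ^ (Nat.log p x + 1) := by exact_mod_cast hlt
      have hJ' : (2 : ℝ) ≤ (Nat.log p x : ℝ) := by exact_mod_cast hJ
      rw [one_div, inv_pow, div_le_div_iff₀ (by apply mul_pos <;> [positivity; (rw [one_div] at hu1; linarith)]) (by positivity)]
      have e1 : ((p : ℝ) ^ (Nat.log p x + 1))⁻¹ * (3 * x) ≤ 3 := by
        rw [inv_mul_le_iff₀ (by positivity)]; linarith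
      rw [one_div] at hu1
      have e2 : 3 * (1 / 2) ≤ ((Nat.log p x : ℝ) + 1) * (1 - (p : ℝ)⁻¹) := by
        apply mul_le_mul <;> linarith
      linarith
    · have hJ : 1 ≤ Nat.log p x := by
        apply Nat.le_log_of_pow_le hp.2.one_lt
        rw [pow_one]; exact hp.1.2
      have hJ' : (1 : ℝ) ≤ (Nat.log p x : ℝ) := by exact_mod_cast hJ
      have e1 : (1 / (p : ℝ)) ^ (Nat.log p x + 1) ≤ (1 / (p : ℝ)) ^ 2 :=
        pow_le_pow_of_le_one hu.le (by linarith) (by omega)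
      have e2 : 1 / 2 * (1 / ((p : ℝ) - 1) - 1 / p) = (1 / (p : ℝ)) ^ 2 / (2 * (1 - 1 / p)) := by
        have : (p : ℝ) - 1 ≠ 0 := by linarith
        field_simp
        ring
      rw [e2]
      apply div_le_div₀ (by positivity) e1
      · apply mul_pos (by norm_num); linarith
      · apply mul_le_mul_of_nonneg_right <;> linarith
  have h1 := Finset.sum_le_sum per
  rw [Finset.sum_add_distrib] at h1
  have h2 := N1_ge x
  have h3 : ∑ p ∈ (Ioc 0 x).filter Nat.Prime, (if p ≤ s then 2 / (3 * (x : ℝ)) else 1 / 2 * (1 / ((p : ℝ) - 1) - 1 / p))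
      ≤ ∑ p ∈ Ioc 1 x, (if p ≤ s then 2 / (3 * (x : ℝ)) else 1 / 2 * (1 / ((p : ℝ) - 1) - 1 / p)) := by
    apply Finset.sum_le_sum_of_subset_of_nonneg
    · intro p hp
      rw [mem_filter, mem_Ioc] at hp
      rw [mem_Ioc]
      exact ⟨hp.2.one_lt, hp.1.2⟩
    · intro p hp _
      rw [mem_Ioc] at hp
      have : (1 : ℝ) < p := by exact_mod_cast hp.1
      split_ifs
      · positivity
      · apply mul_nonneg (by norm_num)
        rw [sub_nonneg]
        apply one_div_le_one_div_of_le <;> linarith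
  rw [← Finset.sum_Ioc_consecutive _ (by omega : 1 ≤ s) hsle] at h3
  have h4 : ∑ p ∈ Ioc 1 s, (if p ≤ s then 2 / (3 * (x : ℝ)) else 1 / 2 * (1 / ((p : ℝ) - 1) - 1 / p))
     ≤ 2 / (3 * s) := by
    rw [Finset.sum_congr rfl (g := fun _ => 2 / (3 * (x : ℝ))) (by
      intro p hp
      rw [mem_Ioc] at hp
      rw [if_pos hp.2])]
    rw [Finset.sum_const, Nat.card_Ioc, nsmul_eq_mul]
    have : ((s - 1 : ℕ) : ℝ) ≤ s := by exact_mod_cast (by omega : s - 1 ≤ s)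
    calc ((s - 1 : ℕ) : ℝ) * (2 / (3 * x)) ≤ s * (2 / (3 * x)) := by gcongr
      _ ≤ 2 / (3 * s) := by
        rw [mul_div_assoc', div_le_div_iff₀ (by positivity) (by positivity)]
        nlinarith
  have h5 : ∀ y, s ≤ y → ∑ p ∈ Ioc s y, (if p ≤ s then 2 / (3 * (x : ℝ)) else 1 / 2 * (1 / ((p : ℝ) - 1) - 1 / p))
     = 1 / 2 * (1 / s - 1 / y) := by
    intro y hy
    induction y, hy using Nat.le_induction with
    | base => simp
    | succ k hk ih =>
      rw [Finset.sum_Ioc_succ_top hk, ih, if_neg (by omega)]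
      push_cast
      ring
  rw [h5 x hsle] at h3
  have h6 : 0 < 1 / (x : ℝ) := by positivity
  have h7 : 7 / (6 * (s : ℝ)) = 2 / (3 * s) + 1 / 2 * (1 / s) := by field_simp; norm_num
  rw [MM]
  linarith

end RobinAux


namespace RobinAux
open ArithmeticFunction (vonMangoldt)

lemma ab_of {X : ℕ} {a b : ℝ} (hX : 8 ≤ X) (h1 : Real.log X ≤ a * √X) (h2 : 1 ≤ b * √X) (n : ℕ) (hn : X ≤ n) :
    Real.log n ≤ a * √n ∧ 1 ≤ b * √n := by
  have hX' : (8 : ℝ) ≤ X := by exact_mod_cast hX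
  have hn' : (X : ℝ) ≤ n := by exact_mod_cast hn
  have hsX : 0 < √(X : ℝ) := by positivity
  have hsn : √(X : ℝ) ≤ √n := Real.sqrt_le_sqrt hn'
  have he : Real.exp 2 ≤ 8 := by
    have := Real.exp_one_lt_d9
    have h3 : Real.exp 2 = Real.exp 1 * Real.exp 1 := by rw [← Real.exp_add]; norm_num
    rw [h3]
    have := Real.exp_pos 1
    nlinarith
  have hm := Real.log_div_sqrt_antitoneOn (Set.mem_Ici.2 (he.trans hX')) (Set.mem_Ici.2 (he.trans (hX'.trans hn'))) hn'
  simp only at hm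
  constructor
  · have : Real.log X / √X ≤ a := by rw [div_le_iff₀ hsX]; exact h1
    have := hm.trans this
    rwa [div_le_iff₀ (by linarith)] at this
  · have hb : 0 < b := by
      by_contra hb
      have := mul_nonneg (by linarith : 0 ≤ -b) hsX.le
      linarith
    nlinarith

lemma ab1 (n : ℕ) (hn : 32768 ≤ n) : Real.log n ≤ 0.05745 * √n ∧ 1 ≤ 0.005525 * √n := by
  have h : (181.01 : ℝ) ≤ √(32768 : ℕ) := by
    apply Real.le_sqrt_of_sq_le; norm_num
  apply ab_of (by norm_num) _ _ n hn
  · have : Real.log ((32768 : ℕ) : ℝ) = 15 * Real.log 2 := by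
      rw [show ((32768 : ℕ) : ℝ) = 2 ^ 15 by norm_num, Real.log_pow]; norm_num
    rw [this]
    have := Real.log_two_lt_d9
    linarith
  · linarith

lemma ab2 (n : ℕ) (hn : 2900000000 ≤ n) : Real.log n ≤ 0.0005 * √n ∧ 1 ≤ 0.00002 * √n := by
  have h : (53800 : ℝ) ≤ √(2900000000 : ℕ) := by
    apply Real.le_sqrt_of_sq_le; norm_num
  have hl : Real.log ((2900000000 : ℕ) : ℝ) ≤ 32 * Real.log 2 := by
    rw [← Real.log_rpow (by norm_num)]
    apply Real.log_le_log <;> norm_num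
  have h2 := Real.log_two_lt_d9
  refine ab_of (by norm_num) (hl.trans ?_) ?_ n hn
  · revert h
    generalize √((2900000000 : ℕ) : ℝ) = s
    intro h
    linarith
  · revert h
    generalize √((2900000000 : ℕ) : ℝ) = s
    intro h
    linarith

/-- the error bound -/
lemma err_bd {a b : ℝ} {n : ℕ} (hn : 1 ≤ n) (h1 : Real.log n ≤ a * √n) (h2 : 1 ≤ b * √n) :
    ps n ≤ n * (1.1056 + 1.5 * (a + b) ^ 2 + 101 * b ^ 2) := by
  have h := ps_le n hn
  have hn' : (1 : ℝ) ≤ n := by exact_mod_cast hn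
  have hl : 0 ≤ Real.log n := Real.log_nonneg hn'
  have hs : √(n : ℝ) ^ 2 = n := Real.sq_sqrt (by linarith)
  have e1 : (Real.log n + 1) ^ 2 ≤ ((a + b) * √n) ^ 2 := pow_le_pow_left₀ (by linarith) (by linarith) 2
  have e2 : (1 : ℝ) ^ 2 ≤ (b * √n) ^ 2 := pow_le_pow_left₀ (by linarith) (by linarith) 2
  rw [mul_pow, hs] at e1 e2
  nlinarith

lemma ps5_bd {a b : ℝ} {n : ℕ} (hn : 5 ≤ n) (h1 : Real.log n ≤ a * √n) (h2 : 1 ≤ b * √n) :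
    ps (n / 5) ≤ n * (0.22112 + 1.5 * (a + b) ^ 2 + 101 * b ^ 2) := by
  have hn5 : 1 ≤ n / 5 := by omega
  have h := ps_le (n / 5) hn5
  have hn' : (1 : ℝ) ≤ n := by exact_mod_cast (by omega : 1 ≤ n)
  have hn5' : (1 : ℝ) ≤ (n / 5 : ℕ) := by exact_mod_cast hn5
  have hle : ((n / 5 : ℕ) : ℝ) ≤ n / 5 := Nat.cast_div_le
  have hl : 0 ≤ Real.log (n / 5 : ℕ) := Real.log_nonneg hn5'
  have hll : Real.log (n / 5 : ℕ) ≤ Real.log n := Real.log_le_log (by linarith) (by linarith)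
  have hs : √(n : ℝ) ^ 2 = n := Real.sq_sqrt (by linarith)
  have e1 : (Real.log (n / 5 : ℕ) + 1) ^ 2 ≤ ((a + b) * √n) ^ 2 := pow_le_pow_left₀ (by linarith) (by linarith) 2
  have e2 : (1 : ℝ) ^ 2 ≤ (b * √n) ^ 2 := pow_le_pow_left₀ (by linarith) (by linarith) 2
  rw [mul_pow, hs] at e1 e2
  nlinarith

lemma MM_bd {a b w : ℝ} {X : ℕ} (hX : 1000 ≤ X) (hb1 : b ≤ 1 / 2) (hab : ∀ n, X ≤ n → Real.log n ≤ a * √n ∧ 1 ≤ b * √n)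
    (hw : 30 * a * b + 0.16 * (0.22112 + 1.5 * (a + b) ^ 2 + 101 * b ^ 2) + b ^ 2 ≤ w) (x : ℕ) (hx : X ≤ x) :
    MM x ≤ Real.eulerMascheroniConstant + Real.log (Real.log x) +
      (ps x / x - 1 + w * (1 + 1 / Real.log x) + 7 * a / (6 * (1 - b))) / Real.log x := by
  set err := 0.22112 + 1.5 * (a + b) ^ 2 + 101 * b ^ 2 with herr
  have key : ∀ n : ℕ, X ≤ n → Real.log n + (C0 - 15 * a * b - 0.13 * err) ≤ WW n ∧
      WW n ≤ Real.log n + (C0 + 15 * a * b + 0.03 * err) := by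
    intro n hn
    obtain ⟨h1, h2⟩ := hab n hn
    have h5 := ps5_bd (by omega) h1 h2
    rw [← herr] at h5
    have hn' : (1000 : ℝ) ≤ n := by exact_mod_cast hX.trans hn
    have hs : √(n : ℝ) ^ 2 = n := Real.sq_sqrt (by linarith)
    have hl : 0 ≤ Real.log n := Real.log_nonneg (by linarith)
    have hs0 : 0 ≤ √(n : ℝ) := by positivity
    have e : Real.log n ≤ n * (a * b) := by
      have := mul_le_mul h1 h2 (by norm_num) (by linarith)
      calc Real.log n = Real.log n * 1 := by ring
        _ ≤ a * √n * (b * √n) := this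
        _ = (√n) ^ 2 * (a * b) := by ring
        _ = _ := by rw [hs]
    obtain ⟨v1, v2⟩ := VV_bd n (hX.trans hn)
    rw [WW, le_div_iff₀ (by linarith), div_le_iff₀ (by linarith)]
    constructor <;> linarith
  have hN := N1_le gamma_freq _ _ X (by omega) (fun n hn => (key n hn).1) x hx (key x hx).2
  have hM := MM_le x (by omega)
  have hx' : (1000 : ℝ) ≤ x := by exact_mod_cast hX.trans hx
  have hX' : (1000 : ℝ) ≤ X := by exact_mod_cast hX
  have hL : 0 < Real.log x := Real.log_pos (by linarith)
  obtain ⟨h1, h2⟩ := hab x hx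
  have hs : √(x : ℝ) ^ 2 = x := Real.sq_sqrt (by linarith)
  have hs0 : 0 < √(x : ℝ) := by positivity
  have hXb : 1 / (X : ℝ) ≤ b ^ 2 := by
    have := (hab X le_rfl).2
    have e2 : (1 : ℝ) ^ 2 ≤ (b * √X) ^ 2 := pow_le_pow_left₀ (by norm_num) (by linarith) 2
    rw [mul_pow, Real.sq_sqrt (by linarith)] at e2
    rw [div_le_iff₀ (by linarith)]
    linarith
  have hsq : (1 - b) * √x ≤ Nat.sqrt x := by
    have : √(x : ℝ) < Nat.sqrt x + 1 := by
      rw [Real.sqrt_lt' (by positivity)]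
      have := Nat.lt_succ_sqrt' x
      exact_mod_cast this
    linarith
  have hsq0 : 0 < (1 - b) * √x := mul_pos (by linarith) hs0
  have t1 : 7 / (6 * (Nat.sqrt x : ℝ)) ≤ 7 * a / (6 * (1 - b)) / Real.log x := by
    rw [div_div, div_le_div_iff₀ (by linarith) (by apply mul_pos _ hL; linarith)]
    have ha : 0 < a := by
      by_contra ha
      have := mul_nonneg (by linarith : 0 ≤ -a) hs0.le
      linarith
    have t2 := mul_le_mul_of_nonneg_left hsq ha.le
    have t3 := mul_le_mul_of_nonneg_left h1 (by linarith : 0 ≤ 1 - b)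
    nlinarith
  have t4 : (C0 + 15 * a * b + 0.03 * err - (C0 - 15 * a * b - 0.13 * err) + 1 / X) * (1 + 1 / Real.log x)
     ≤ w * (1 + 1 / Real.log x) := by
    apply mul_le_mul_of_nonneg_right _ (by positivity)
    linarith
  have t5 : (ps x / x - 1 + (C0 + 15 * a * b + 0.03 * err - (C0 - 15 * a * b - 0.13 * err) + 1 / X) * (1 + 1 / Real.log x)) / Real.log x
     ≤ (ps x / x - 1 + w * (1 + 1 / Real.log x)) / Real.log x := by
    apply div_le_div_of_nonneg_right _ hL.le
    linarith
  rw [add_div _ (7 * a / (6 * (1 - b)))]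
  linarith

lemma psi_ps (y : ℝ) : Chebyshev.psi y = ps ⌊y⌋₊ := by
  rw [Chebyshev.psi, ps]

lemma psi_theta {a b : ℝ} {x : ℕ} (hx : 4 ≤ x) (h1 : Real.log x ≤ a * √x) (h2 : 1 ≤ b * √x) :
    ps x - Chebyshev.theta x ≤ 3 * x * (1.1056 * b + 1.5 * (a / 2 + b) ^ 2 + 101 * b ^ 2) := by
  have hx' : (4 : ℝ) ≤ x := by exact_mod_cast hx
  have h := Chebyshev.psi_sub_theta_le_psi_add_psi_add_psi (x : ℝ)
  have m : ∀ t : ℝ, t ≤ (2 : ℝ)⁻¹ → Chebyshev.psi ((x : ℝ) ^ t) ≤ ps ⌊√(x : ℝ)⌋₊ := by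
    intro t ht
    rw [← psi_ps]
    apply Chebyshev.psi_mono
    rw [Real.sqrt_eq_rpow]
    apply Real.rpow_le_rpow_of_exponent_le (by linarith)
    linarith
  have e0 : ps x = Chebyshev.psi x := by rw [psi_ps]; simp
  have m2 := m (2 : ℝ)⁻¹ le_rfl
  have m3 := m (3 : ℝ)⁻¹ (by norm_num)
  have m5 := m (5 : ℝ)⁻¹ (by norm_num)
  have hs : √(x : ℝ) ^ 2 = x := Real.sq_sqrt (by linarith)
  have hs2 : 2 ≤ √(x : ℝ) := Real.le_sqrt_of_sq_le (by linarith)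
  have hf : 1 ≤ ⌊√(x : ℝ)⌋₊ := Nat.le_floor (by push_cast; linarith)
  have hp := ps_le _ hf
  have hfl : (⌊√(x : ℝ)⌋₊ : ℝ) ≤ √x := Nat.floor_le (by positivity)
  have hf' : (1 : ℝ) ≤ (⌊√(x : ℝ)⌋₊ : ℝ) := by exact_mod_cast hf
  have hl0 : 0 ≤ Real.log (⌊√(x : ℝ)⌋₊ : ℝ) := Real.log_nonneg hf'
  have hl : Real.log (⌊√(x : ℝ)⌋₊ : ℝ) ≤ Real.log x / 2 := by
    rw [← Real.log_sqrt (by linarith)]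
    exact Real.log_le_log (by linarith) hfl
  have e1 : (Real.log (⌊√(x : ℝ)⌋₊ : ℝ) + 1) ^ 2 ≤ ((a / 2 + b) * √x) ^ 2 := pow_le_pow_left₀ (by linarith) (by linarith) 2
  have e2 : (1 : ℝ) ^ 2 ≤ (b * √x) ^ 2 := pow_le_pow_left₀ (by linarith) (by linarith) 2
  rw [mul_pow, hs] at e1 e2
  have e3 : √(x : ℝ) ≤ x * b := by nlinarith
  nlinarith

end RobinAux


namespace RobinAux

noncomputable def np (i : ℕ) : ℕ := Nat.nth Nat.Prime i

lemma np_prime (i : ℕ) : (np i).Prime := Nat.prime_nth_prime i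

lemma sum_anti (f : ℕ → ℝ) (hf : ∀ p q, Nat.Prime p → Nat.Prime q → p ≤ q → f q ≤ f p) (s : Finset ℕ) :
    (∀ p ∈ s, Nat.Prime p) → ∑ p ∈ s, f p ≤ ∑ i ∈ range s.card, f (np i) := by
  induction s using Finset.induction_on_max with
  | empty => simp
  | insert a s ha ih =>
    intro hs
    have hna : a ∉ s := fun h => lt_irrefl _ (ha a h)
    rw [Finset.sum_insert hna, Finset.card_insert_of_notMem hna, Finset.sum_range_succ, add_comm]
    have hle : np s.card ≤ a := by
      apply Nat.lt_succ_iff.1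
      apply Nat.nth_lt_of_lt_count
      rw [Nat.count_eq_card_filter_range]
      apply Nat.lt_of_lt_of_le (Nat.lt_succ_self _)
      rw [Nat.succ_eq_add_one, ← Finset.card_insert_of_notMem hna]
      apply Finset.card_le_card
      intro p hp
      rw [mem_filter, mem_range]
      refine ⟨?_, hs p hp⟩
      rcases mem_insert.1 hp with rfl | h
      · omega
      · have := ha p h; omega
    apply add_le_add
    · exact ih (fun p hp => hs p (mem_insert_of_mem hp))
    · exact hf _ _ (np_prime _) (hs a (mem_insert_self _ _)) hle

lemma one_sub_pos {p : ℕ} (hp : p.Prime) : 0 < 1 - 1 / (p : ℝ) := by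
  have : (2 : ℝ) ≤ p := by exact_mod_cast hp.two_le
  have : 1 / (p : ℝ) ≤ 1 / 2 := one_div_le_one_div_of_le (by norm_num) this
  linarith

lemma sigma_le (n : ℕ) (hn : 0 < n) :
    (ArithmeticFunction.sigma 1 n : ℝ) / n ≤ Real.exp (∑ i ∈ range n.primeFactors.card, -Real.log (1 - 1 / (np i : ℝ))) := by
  have h1 : (ArithmeticFunction.sigma 1 n : ℝ) / n ≤ ∏ p ∈ n.primeFactors, (1 - 1 / (p : ℝ))⁻¹ := by
    rw [ArithmeticFunction.sigma_eq_prod_primeFactors_sum_range_factorization_pow_mul hn.ne']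
    have hn2 : (n : ℝ) = ∏ p ∈ n.primeFactors, (p : ℝ) ^ (n.factorization p) := by
      conv_lhs => rw [← Nat.prod_factorization_pow_eq_self hn.ne']
      rw [Finsupp.prod, Nat.support_factorization]
      push_cast
      rfl
    rw [hn2]
    push_cast
    rw [← Finset.prod_div_distrib]
    apply Finset.prod_le_prod
    · intro p _; positivity
    · intro p hp
      have hp := Nat.prime_of_mem_primeFactors hp
      have hp1 : (1 : ℝ) < p := by exact_mod_cast hp.one_lt
      simp only [mul_one]
      rw [geom_sum_eq (by linarith), div_le_iff₀ (by positivity), div_le_iff₀ (by linarith), one_sub_div (by linarith), inv_div]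
      have : (p : ℝ) - 1 ≠ 0 := by linarith
      field_simp
      rw [pow_succ']
      linarith
  refine h1.trans ?_
  have h2 : ∏ p ∈ n.primeFactors, (1 - 1 / (p : ℝ))⁻¹ = Real.exp (∑ p ∈ n.primeFactors, -Real.log (1 - 1 / (p : ℝ))) := by
    rw [Real.exp_sum]
    apply Finset.prod_congr rfl
    intro p hp
    rw [Real.exp_neg, Real.exp_log (one_sub_pos (Nat.prime_of_mem_primeFactors hp))]
  rw [h2, Real.exp_le_exp]
  apply sum_anti (fun p => -Real.log (1 - 1 / (p : ℝ)))
  · intro p q hp hq hpq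
    apply neg_le_neg
    apply Real.log_le_log (one_sub_pos hp)
    have : (0 : ℝ) < p := by exact_mod_cast hp.pos
    have : 1 / (q : ℝ) ≤ 1 / p := one_div_le_one_div_of_le this (by exact_mod_cast hpq)
    linarith
  · intro p hp; exact Nat.prime_of_mem_primeFactors hp

lemma log_n_ge (n : ℕ) (hn : 0 < n) :
    ∑ i ∈ range n.primeFactors.card, Real.log (np i) +
    ∑ i ∈ range (n.primeFactors.filter (fun p => p ^ 2 ∣ n)).card, Real.log (np i) ≤ Real.log n := by
  have h0 : Real.log n = ∑ p ∈ n.primeFactors, (n.factorization p : ℝ) * Real.log p := by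
    conv_lhs => rw [← Nat.prod_factorization_pow_eq_self hn.ne']
    rw [Finsupp.prod, Nat.support_factorization]
    push_cast
    rw [Real.log_prod]
    · apply Finset.sum_congr rfl
      intro p _
      rw [Real.log_pow]
    · intro p hp
      have := (Nat.prime_of_mem_primeFactors hp).pos
      positivity
  have hmono : ∀ p q, Nat.Prime p → Nat.Prime q → p ≤ q → -Real.log q ≤ -Real.log p := by
    intro p q hp hq hpq
    apply neg_le_neg
    exact Real.log_le_log (by exact_mod_cast hp.pos) (by exact_mod_cast hpq)
  have h1 := sum_anti (fun p => -Real.log p) hmono n.primeFactors (fun p hp => Nat.prime_of_mem_primeFactors hp)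
  have h2 := sum_anti (fun p => -Real.log p) hmono (n.primeFactors.filter (fun p => p ^ 2 ∣ n))
    (fun p hp => Nat.prime_of_mem_primeFactors (mem_filter.1 hp).1)
  simp only [Finset.sum_neg_distrib] at h1 h2
  have h3 : ∑ p ∈ n.primeFactors, Real.log p + ∑ p ∈ n.primeFactors.filter (fun p => p ^ 2 ∣ n), Real.log p ≤ Real.log n := by
    rw [h0, Finset.sum_filter, ← Finset.sum_add_distrib]
    apply Finset.sum_le_sum
    intro p hp
    have hpp := Nat.prime_of_mem_primeFactors hp
    have hl : 0 ≤ Real.log p := Real.log_natCast_nonneg p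
    split_ifs with h
    · have : 2 ≤ n.factorization p := (hpp.pow_dvd_iff_le_factorization hn.ne').1 h
      have : (2 : ℝ) ≤ n.factorization p := by exact_mod_cast this
      nlinarith
    · have : 1 ≤ n.factorization p := (hpp.dvd_iff_one_le_factorization hn.ne').1 (Nat.dvd_of_mem_primeFactors hp)
      have : (1 : ℝ) ≤ n.factorization p := by exact_mod_cast this
      nlinarith
  linarith

lemma robin_red (n : ℕ) (hn : 0 < n) (T : ℕ) (hT : T ≤ (n.primeFactors.filter (fun p => p ^ 2 ∣ n)).card) (A : ℝ)
    (hA0 : 1 < A)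
    (hA : A ≤ ∑ i ∈ range n.primeFactors.card, Real.log (np i) + ∑ i ∈ range T, Real.log (np i))
    (hM : Real.exp (∑ i ∈ range n.primeFactors.card, -Real.log (1 - 1 / (np i : ℝ))) <
      Real.exp Real.eulerMascheroniConstant * Real.log A) :
    (ArithmeticFunction.sigma 1 n : ℝ) / n <
      Real.exp Real.eulerMascheroniConstant * Real.log (Real.log n) := by
  refine (sigma_le n hn).trans_lt (hM.trans_le ?_)
  apply mul_le_mul_of_nonneg_left _ (Real.exp_pos _).le
  apply Real.log_le_log (by linarith)
  refine hA.trans (le_trans ?_ (log_n_ge n hn))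
  apply add_le_add le_rfl
  apply Finset.sum_le_sum_of_subset_of_nonneg
  · intro i hi
    rw [mem_range] at *
    omega
  · intro i _ _
    exact Real.log_natCast_nonneg _

lemma sum_np_eq (f : ℕ → ℝ) (k : ℕ) :
    ∑ p ∈ (Ioc 0 (np k)).filter Nat.Prime, f p = ∑ i ∈ range (k + 1), f (np i) := by
  have hinj : Function.Injective np := Nat.nth_injective Nat.infinite_setOfPred_prime
  rw [← Finset.sum_image (f := f) (g := np) (fun a _ b _ h => hinj h)]
  apply Finset.sum_congr _ (fun _ _ => rfl)
  ext p
  simp only [mem_filter, mem_Ioc, mem_image, mem_range]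
  constructor
  · rintro ⟨⟨_, h⟩, hp⟩
    refine ⟨Nat.count Nat.Prime p, ?_, Nat.nth_count hp⟩
    rw [← Nat.count_nth_succ_of_infinite Nat.infinite_setOfPred_prime k]
    apply Nat.count_strict_mono hp
    exact Nat.lt_succ_of_le h
  · rintro ⟨i, hi, rfl⟩
    refine ⟨⟨(np_prime i).pos, ?_⟩, np_prime i⟩
    exact Nat.nth_monotone Nat.infinite_setOfPred_prime (by omega)

lemma MM_np (k : ℕ) : MM (np k) = ∑ i ∈ range (k + 1), -Real.log (1 - 1 / (np i : ℝ)) :=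
  sum_np_eq (fun p => -Real.log (1 - 1 / (p : ℝ))) k

lemma theta_np (k : ℕ) : Chebyshev.theta (np k) = ∑ i ∈ range (k + 1), Real.log (np i) := by
  rw [← sum_np_eq (fun p => Real.log p) k, Chebyshev.theta]
  simp

lemma ps_np (k : ℕ) : ps (np k) ≤ (k + 1) * Real.log (np k) := by
  have h := Chebyshev.psi_le_primeCounting_mul_log (np k)
  rw [psi_ps, Nat.floor_natCast] at h
  have : Nat.primeCounting (np k) = k + 1 := by
    rw [Nat.primeCounting, Nat.primeCounting']
    exact Nat.count_nth_succ_of_infinite Nat.infinite_setOfPred_prime k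
  rw [this] at h
  push_cast at h
  exact h

end RobinAux


namespace RobinAux

lemma np_lt (i : ℕ) : np i < np (i + 1) :=
  (Nat.nth_lt_nth Nat.infinite_setOfPred_prime).2 (Nat.lt_succ_self i)

lemma prime_mod {p : ℕ} (hp : p.Prime) (h : 5 ≤ p) : p % 6 = 1 ∨ p % 6 = 5 := by
  have h2 : ¬ 2 ∣ p := fun hd => by
    have := (Nat.prime_dvd_prime_iff_eq Nat.prime_two hp).1 hd; omega
  have h3 : ¬ 3 ∣ p := fun hd => by
    have := (Nat.prime_dvd_prime_iff_eq Nat.prime_three hp).1 hd; omega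
  omega

lemma np_lower {a m : ℕ} (h : Nat.count Nat.Prime m ≤ a) : m ≤ np a := by
  by_contra hlt
  have h1 : np a + 1 ≤ m := by omega
  have h2 := Nat.count_monotone Nat.Prime h1
  have h3 : Nat.count Nat.Prime (np a + 1) = a + 1 :=
    Nat.count_nth_succ_of_infinite Nat.infinite_setOfPred_prime a
  omega

lemma np_ge (i : ℕ) : 3 * (i + 12) ≤ np (i + 11) := by
  induction i using Nat.strong_induction_on with
  | _ i ih =>
    match i, ih with
    | 0, _ =>
      exact np_lower (a := 11) (m := 36) (by decide +kernel)
    | 1, _ =>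
      exact np_lower (a := 12) (m := 39) (by decide +kernel)
    | j + 2, ih =>
      have h := ih j (by omega)
      have h1 := np_lt (j + 11)
      have h2 := np_lt (j + 12)
      change np (j + 11) < np (j + 12) at h1
      change np (j + 12) < np (j + 13) at h2
      have m0 := prime_mod (np_prime (j + 11)) (by omega)
      have m1 := prime_mod (np_prime (j + 12)) (by omega)
      have m2 := prime_mod (np_prime (j + 13)) (by omega)
      show 3 * (j + 2 + 12) ≤ np (j + 13)
      omega

lemma thT_ge (T : ℕ) (hT : 11 ≤ T) :
    T * (Real.log T + Real.log 3 - 1) - 29 ≤ ∑ i ∈ range T, Real.log (np i) := by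
  have h : T * Real.log 3 + TT T - 30 ≤ ∑ i ∈ range T, Real.log (np i) := by
    induction T, hT using Nat.le_induction with
    | base =>
      have h0 : (0 : ℝ) ≤ ∑ i ∈ range 11, Real.log (np i) :=
        Finset.sum_nonneg (fun i _ => Real.log_natCast_nonneg _)
      have h1 : (11 : ℕ) * Real.log 3 + TT 11 ≤ 30 := by
        have e : TT 11 = Real.log ((39916800 : ℕ) : ℝ) := by
          rw [TT, ← Real.log_prod]
          · congr 1
            rw [← Nat.cast_prod]
            congr 1
          · intro i hi
            rw [mem_Ioc] at hi
            have : (0 : ℝ) < i := by exact_mod_cast hi.1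
            linarith
        have e2 : (11 : ℕ) * Real.log 3 = Real.log (3 ^ 11) := by rw [Real.log_pow]
        rw [e, e2, ← Real.log_mul (by norm_num) (by norm_num)]
        have : Real.log (3 ^ 11 * ((39916800 : ℕ) : ℝ)) ≤ Real.log (2 ^ 43) := by
          apply Real.log_le_log <;> norm_num
        rw [Real.log_pow] at this
        have := Real.log_two_lt_d9
        norm_num at *
        linarith
      linarith
    | succ k hk ih =>
      rw [Finset.sum_range_succ, TT_succ]
      have h1 : (3 * (k + 1) : ℕ) ≤ np k := by
        obtain ⟨j, rfl⟩ := Nat.exists_eq_add_of_le' hk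
        exact np_ge j
      have h2 : Real.log 3 + Real.log (k + 1) ≤ Real.log (np k) := by
        rw [← Real.log_mul (by norm_num) (by positivity)]
        apply Real.log_le_log (by positivity)
        exact_mod_cast h1
      push_cast
      linarith
  have h1 := (TT_bd T (by omega)).1
  rw [ff] at h1
  linarith

/-- lower bound for the second theta sum -/
lemma thT_lower {T k d : ℕ} (hd : 0 < d) {c q L0 : ℝ} (hL0 : 1 ≤ L0) (hT : 11 ≤ T) (hkT : k + 1 ≤ d * T)
    (hL : L0 ≤ Real.log (np k)) (hps : 0.9 * (np k : ℝ) ≤ ps (np k))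
    (hd1 : (d : ℝ) * L0 / (0.9 * 3) * Real.exp 1 ≤ Real.exp (q * L0)) (hq : 1 ≤ q * L0)
    (hc : c ≤ (1 - q) / d) :
    c * ps (np k) - 29 ≤ ∑ i ∈ range T, Real.log (np i) := by
  refine le_trans ?_ (thT_ge T hT)
  set x : ℝ := (np k : ℝ) with hx
  set L := Real.log x with hLdef
  have hx1 : 1 < x := by rw [hx]; exact_mod_cast (np_prime k).one_lt
  have hLpos : 0 < L := by linarith
  have hdr : (0 : ℝ) < d := by exact_mod_cast hd
  have hTr : (11 : ℝ) ≤ T := by exact_mod_cast hT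
  have hP := ps_np k
  rw [← hx, ← hLdef] at hP
  set P := ps (np k) with hPdef
  have hkT' : (k : ℝ) + 1 ≤ d * T := by exact_mod_cast hkT
  have hPT : P ≤ d * T * L := hP.trans (mul_le_mul_of_nonneg_right hkT' hLpos.le)
  have hPpos : 0 < P := by nlinarith
  -- log T bound
  have hT2 : 0.9 * x / (d * L) ≤ T := by
    rw [div_le_iff₀ (by positivity)]; linarith
  have hlT : Real.log 0.9 + L - Real.log d - Real.log L ≤ Real.log T := by
    have := Real.log_le_log (by positivity) hT2
    rw [Real.log_div (by positivity) (by positivity), Real.log_mul (by norm_num) (by linarith),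
      Real.log_mul hdr.ne' hLpos.ne'] at this
    linarith
  have hlL : Real.log L ≤ Real.log L0 + L / L0 - 1 := by
    have := Real.log_le_sub_one_of_pos (show 0 < L / L0 by positivity)
    rw [Real.log_div hLpos.ne' (by linarith)] at this
    linarith
  have hd2 : Real.log d + Real.log L0 - Real.log 0.9 - Real.log 3 + 1 ≤ q * L0 := by
    have := Real.log_le_log (by positivity) hd1
    rw [Real.log_exp, Real.log_mul (by positivity) (by positivity), Real.log_exp,
      Real.log_div (by positivity) (by norm_num), Real.log_mul hdr.ne' (by linarith),
      Real.log_mul (by norm_num) (by norm_num)] at this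
    linarith
  have hr : 1 ≤ L / L0 := by rw [le_div_iff₀ (by linarith)]; linarith
  have hqL : q * L = (q * L0) * (L / L0) := by field_simp
  have hmain : (1 - q) * L ≤ Real.log T + Real.log 3 - 1 := by nlinarith
  have h4 : (1 - q) / d * P ≤ T * (Real.log T + Real.log 3 - 1) := by
    by_cases hq1 : q ≤ 1
    · calc (1 - q) / d * P ≤ (1 - q) / d * (d * T * L) := by
            apply mul_le_mul_of_nonneg_left hPT
            apply div_nonneg <;> linarith
        _ = T * ((1 - q) * L) := by field_simp
        _ ≤ _ := mul_le_mul_of_nonneg_left hmain (by linarith)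
    · have h5 : 0 ≤ Real.log T + Real.log 3 - 1 := by
        have e1 : 1 ≤ Real.log 3 := by
          rw [Real.le_log_iff_exp_le (by norm_num)]
          have := Real.exp_one_lt_d9; linarith
        have e2 : 0 ≤ Real.log T := Real.log_natCast_nonneg T
        linarith
      have : (1 - q) / d * P ≤ 0 := mul_nonpos_of_nonpos_of_nonneg (div_nonpos_of_nonpos_of_nonneg (by linarith) hdr.le) hPpos.le
      have : 0 ≤ T * (Real.log T + Real.log 3 - 1) := mul_nonneg (by linarith) h5
      linarith
  have := mul_le_mul_of_nonneg_right hc hPpos.le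
  linarith

end RobinAux


namespace RobinAux

lemma log_lower {e : ℝ} (h1 : -0.085 ≤ e) (h2 : e ≤ 0.1147) : e - 0.0067 ≤ Real.log (1 + e) ∧
    (e ≤ 0.1057 → e - 0.0056 ≤ Real.log (1 + e)) := by
  have key : e - 0.0056 ≤ Real.log (1 + e) ∨ (0 ≤ e ∧ e - e ^ 2 / 2 ≤ Real.log (1 + e)) := by
    rcases le_total 0 e with h | h
    · right
      refine ⟨h, le_trans ?_ (Real.le_log_one_add_of_nonneg h)⟩
      rw [le_div_iff₀ (by linarith)]
      nlinarith [pow_nonneg h 3]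
    · left
      have h3 := log_le_half (r := (1 + e)⁻¹) ((one_le_inv₀ (by linarith)).2 (by linarith))
      rw [Real.log_inv, inv_inv] at h3
      have h4 : (1 + e)⁻¹ ≤ 1 - e + 0.0112 := by
        rw [inv_le_comm₀ (by linarith) (by linarith), inv_le_iff_one_le_mul₀ (by linarith)]
        nlinarith
      linarith
  rcases key with h | ⟨h0, h⟩
  · exact ⟨by linarith, fun _ => h⟩
  · constructor
    · nlinarith
    · intro h3; nlinarith

lemma log_add_lower {L v : ℝ} (hL : 10 ≤ L) (hv : -0.5 ≤ v) :
    Real.log L + (v - 1.1 * v ^ 2 / L) / L ≤ Real.log (L + v) := by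
  have hLp : 0 < L := by linarith
  have e1 : L + v = L * (1 + v / L) := by rw [mul_add, mul_div_cancel₀ _ hLp.ne', mul_one]
  have hz1 : -0.05 ≤ v / L := by rw [le_div_iff₀ hLp]; linarith
  rw [e1, Real.log_mul hLp.ne' (by linarith)]
  have h2 := Real.one_sub_inv_le_log_of_pos (show 0 < 1 + v / L by linarith)
  have h3 : (v - 1.1 * v ^ 2 / L) / L = v / L - 1.1 * (v / L) ^ 2 := by field_simp
  rw [h3]
  generalize v / L = z at *
  have h4 : z - 1.1 * z ^ 2 ≤ 1 - (1 + z)⁻¹ := by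
    have : (1 + z)⁻¹ = 1 - z + z ^ 2 * (1 + z)⁻¹ := by
      have : 1 + z ≠ 0 := by linarith
      field_simp
      ring
    have h5 : (1 + z)⁻¹ ≤ 1.1 := by
      rw [inv_le_iff_one_le_mul₀ (by linarith)]; linarith
    have h6 := mul_le_mul_of_nonneg_left h5 (sq_nonneg z)
    linarith
  linarith

set_option maxHeartbeats 1000000 in
lemma final {a b w c g κ l V L0 : ℝ} {X k T : ℕ} (hX : 1000 ≤ X) (hb1 : b ≤ 1 / 2)
    (hab : ∀ n, X ≤ n → Real.log n ≤ a * √n ∧ 1 ≤ b * √n)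
    (hw0 : 0 ≤ w)
    (hw : 30 * a * b + 0.16 * (0.22112 + 1.5 * (a + b) ^ 2 + 101 * b ^ 2) + b ^ 2 ≤ w)
    (hx : X ≤ np k) (hL0 : 10 ≤ L0) (hL : L0 ≤ Real.log (np k))
    (hlow : 5 * a * b + b ^ 2 ≤ 0.006)
    (hT : c * ps (np k) - 29 ≤ ∑ i ∈ range T, Real.log (np i)) (hκ0 : 0 ≤ κ) (hκc : κ ≤ c)
    (hκ : 3 * (1.1056 * b + 1.5 * (a / 2 + b) ^ 2 + 101 * b ^ 2) + 29 * b ^ 2 ≤ (c - κ) * 0.9)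
    (hg : ∀ e : ℝ, -0.085 ≤ e → e ≤ 0.1056 + 1.5 * (a + b) ^ 2 + 101 * b ^ 2 → e - g ≤ Real.log (1 + e) ∧ |e - g + l| ≤ V)
    (hl : l ≤ Real.log (1 + κ)) (hV : V ≤ 0.5)
    (hnum : w * (1 + 1 / L0) + 7 * a / (6 * (1 - b)) + g + 1.1 * V ^ 2 / L0 < l) :
    ∃ A : ℝ, 1 < A ∧ A ≤ ∑ i ∈ range (k + 1), Real.log (np i) + ∑ i ∈ range T, Real.log (np i) ∧
      Real.exp (∑ i ∈ range (k + 1), -Real.log (1 - 1 / (np i : ℝ))) <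
      Real.exp Real.eulerMascheroniConstant * Real.log A := by
  have hM := MM_bd hX hb1 hab hw (np k) hx
  obtain ⟨hab1, hab2⟩ := hab _ hx
  have hxr : (1000 : ℝ) ≤ np k := by exact_mod_cast hX.trans hx
  have hth := psi_theta (by omega) hab1 hab2
  have hup := err_bd (by omega) hab1 hab2
  have hlo := le_ps (np k) (by omega)
  rw [MM_np] at hM
  rw [theta_np] at hth
  have hs : √(np k : ℝ) ^ 2 = np k := Real.sq_sqrt (by linarith)
  have hs0 : 0 < √(np k : ℝ) := by positivity
  have h1b : 1 ≤ (np k : ℝ) * b ^ 2 := by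
    have e2 : (1 : ℝ) ^ 2 ≤ (b * √(np k : ℝ)) ^ 2 := pow_le_pow_left₀ (by norm_num) (by linarith) 2
    rw [mul_pow, hs] at e2
    linarith
  have hLab : Real.log (np k) ≤ (np k : ℝ) * (a * b) := by
    have := mul_le_mul hab1 hab2 (by norm_num) (by linarith)
    calc Real.log (np k) = Real.log (np k) * 1 := by ring
      _ ≤ a * √(np k) * (b * √(np k)) := this
      _ = (√(np k)) ^ 2 * (a * b) := by ring
      _ = _ := by rw [hs]
  set x : ℝ := (np k : ℝ) with hxdef
  set P := ps (np k) with hP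
  set L := Real.log x with hLdef
  set e := P / x - 1 with he
  have hPe : P = x * (1 + e) := by rw [he]; field_simp; ring
  have he1 : -0.085 ≤ e := by
    have : 0.915 * x ≤ P := by nlinarith
    rw [he, le_sub_iff_add_le, le_div_iff₀ (by linarith)]
    linarith
  have he2 : e ≤ 0.1056 + 1.5 * (a + b) ^ 2 + 101 * b ^ 2 := by
    rw [he, sub_le_iff_le_add, div_le_iff₀ (by linarith)]
    linarith
  obtain ⟨hg1, hg2⟩ := hg e he1 he2
  set v := e - g + l with hv
  obtain ⟨hv1, hv2⟩ := abs_le.1 hg2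
  have hPx : 0.9 * x ≤ P := by rw [hPe]; nlinarith
  have hPpos : 0 < P := by linarith
  have hApos : 0 < P * (1 + κ) := by positivity
  have hlogA : L + v ≤ Real.log (P * (1 + κ)) := by
    rw [Real.log_mul hPpos.ne' (by linarith), hPe, Real.log_mul (by linarith) (by linarith)]
    linarith
  have hLv : 0 < L + v := by linarith
  have hz := log_add_lower (by linarith : 10 ≤ L) (by linarith : -0.5 ≤ v)
  have hLL : (0 : ℝ) < L := by linarith
  have hcmp : e + w * (1 + 1 / L) + 7 * a / (6 * (1 - b)) < v - 1.1 * v ^ 2 / L := by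
    have h1 : 1 / L ≤ 1 / L0 := one_div_le_one_div_of_le (by linarith) hL
    have h2 : w * (1 + 1 / L) ≤ w * (1 + 1 / L0) := mul_le_mul_of_nonneg_left (by linarith) hw0
    have h3 : v ^ 2 ≤ V ^ 2 := sq_le_sq' hv1 hv2
    have h4 : 1.1 * v ^ 2 / L ≤ 1.1 * V ^ 2 / L0 := by
      apply div_le_div₀ (by positivity) (by linarith) (by linarith) hL
    linarith
  refine ⟨P * (1 + κ), ?_, ?_, ?_⟩
  · have : 0 ≤ P * κ := mul_nonneg hPpos.le hκ0
    linarith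
  · have : (c - κ) * (0.9 * x) ≤ (c - κ) * P := mul_le_mul_of_nonneg_left hPx (by linarith)
    have := mul_le_mul_of_nonneg_left hκ (by linarith : 0 ≤ x)
    linarith
  · have hlp : 0 < Real.log (P * (1 + κ)) := by linarith
    rw [← Real.exp_log hlp, ← Real.exp_add, Real.exp_lt_exp]
    refine hM.trans_lt ?_
    have h1 : Real.log (L + v) ≤ Real.log (Real.log (P * (1 + κ))) := Real.log_le_log hLv hlogA
    have h2 := div_lt_div_of_pos_right hcmp hLL
    linarith

lemma big2 (k T : ℕ) (hk : 32768 ≤ np k) (hT : 11 ≤ T) (hkT : k + 1 ≤ 3 * T) :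
    ∃ A : ℝ, 1 < A ∧ A ≤ ∑ i ∈ range (k + 1), Real.log (np i) + ∑ i ∈ range T, Real.log (np i) ∧
      Real.exp (∑ i ∈ range (k + 1), -Real.log (1 - 1 / (np i : ℝ))) <
      Real.exp Real.eulerMascheroniConstant * Real.log A := by
  have hxr : (32768 : ℝ) ≤ np k := by exact_mod_cast hk
  have hL : 10.39 ≤ Real.log (np k) := by
    have h1 : Real.log (2 ^ 15) ≤ Real.log (np k) := Real.log_le_log (by norm_num) (by linarith)
    rw [Real.log_pow] at h1
    have := Real.log_two_gt_d9
    push_cast at h1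
    linarith
  obtain ⟨h1, h2⟩ := ab1 _ hk
  have hlo := le_ps (np k) (by omega)
  have hps : 0.9 * (np k : ℝ) ≤ ps (np k) := by
    have hs : √(np k : ℝ) ^ 2 = np k := Real.sq_sqrt (by linarith)
    have hs0 : 0 < √(np k : ℝ) := by positivity
    nlinarith
  have hTT : 0.22 * ps (np k) - 29 ≤ ∑ i ∈ range T, Real.log (np i) := by
    apply thT_lower (d := 3) (q := 0.34) (L0 := 10.39) (by norm_num) (by norm_num) hT hkT hL hps
    · have e1 := Real.exp_one_gt_d9
      have e2 := Real.exp_one_lt_d9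
      have e3 : Real.exp (0.34 * 10.39) = Real.exp 1 ^ 3 * Real.exp 0.5326 := by
        rw [← Real.exp_nat_mul, ← Real.exp_add]; norm_num
      have e4 := Real.quadratic_le_exp_of_nonneg (show (0 : ℝ) ≤ 0.5326 by norm_num)
      have e5 : (2.718 : ℝ) ^ 3 ≤ Real.exp 1 ^ 3 := pow_le_pow_left₀ (by norm_num) (by linarith) 3
      have e6 := mul_le_mul e5 e4 (by norm_num) (by positivity)
      rw [e3]
      push_cast
      norm_num at e6 ⊢
      linarith
    · norm_num
    · norm_num
  refine final (a := 0.05745) (b := 0.005525) (w := 0.0464) (g := 0.0067) (κ := 0.18) (l := 0.165) (V := 0.28)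
    (L0 := 10.39) (X := 32768) (by norm_num) (by norm_num) ab1 (by norm_num) (by norm_num) hk (by norm_num) hL (by norm_num)
    hTT (by norm_num) (by norm_num) (by norm_num) ?_ ?_ (by norm_num) (by norm_num)
  · intro e he1 he2
    have he3 : e ≤ 0.1147 := by norm_num at he2; linarith
    refine ⟨(log_lower he1 he3).1, ?_⟩
    rw [abs_le]; constructor <;> linarith
  · refine le_trans ?_ (Real.le_log_one_add_of_nonneg (by norm_num))
    norm_num

lemma big3 (k T : ℕ) (hk : 2900000000 ≤ np k) (hT : 11 ≤ T) (hkT : k + 1 ≤ 14 * T) :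
    ∃ A : ℝ, 1 < A ∧ A ≤ ∑ i ∈ range (k + 1), Real.log (np i) + ∑ i ∈ range T, Real.log (np i) ∧
      Real.exp (∑ i ∈ range (k + 1), -Real.log (1 - 1 / (np i : ℝ))) <
      Real.exp Real.eulerMascheroniConstant * Real.log A := by
  have hxr : (2900000000 : ℝ) ≤ np k := by exact_mod_cast hk
  have hL : 21.78 ≤ Real.log (np k) := by
    have h1 : Real.log (2 ^ 31 * (1 + 0.35)) ≤ Real.log (np k) := Real.log_le_log (by norm_num) (by linarith)
    rw [Real.log_mul (by norm_num) (by norm_num), Real.log_pow] at h1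
    have := Real.log_two_gt_d9
    have h3 := Real.le_log_one_add_of_nonneg (show (0 : ℝ) ≤ 0.35 by norm_num)
    norm_num at h1 h3 ⊢
    linarith
  obtain ⟨h1, h2⟩ := ab2 _ hk
  have hlo := le_ps (np k) (by omega)
  have hps : 0.9 * (np k : ℝ) ≤ ps (np k) := by
    have hs : √(np k : ℝ) ^ 2 = np k := Real.sq_sqrt (by linarith)
    have hs0 : 0 < √(np k : ℝ) := by positivity
    nlinarith
  have hTT : 0.05257 * ps (np k) - 29 ≤ ∑ i ∈ range T, Real.log (np i) := by
    apply thT_lower (d := 14) (q := 0.264) (L0 := 21.78) (by norm_num) (by norm_num) hT hkT hL hps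
    · have e1 := Real.exp_one_gt_d9
      have e2 := Real.exp_one_lt_d9
      have e3 : Real.exp (0.264 * 21.78) = Real.exp 1 ^ 5 * Real.exp 0.37496 ^ 2 := by
        rw [← Real.exp_nat_mul, ← Real.exp_nat_mul, ← Real.exp_add]; norm_num
      have e4 := Real.quadratic_le_exp_of_nonneg (show (0 : ℝ) ≤ 0.37496 by norm_num)
      have e7 := pow_le_pow_left₀ (by norm_num) e4 2
      have e5 : (2.718 : ℝ) ^ 5 ≤ Real.exp 1 ^ 5 := pow_le_pow_left₀ (by norm_num) (by linarith) 5
      have e6 := mul_le_mul e5 e7 (by norm_num) (by positivity)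
      rw [e3]
      push_cast
      norm_num at e6 ⊢
      linarith
    · norm_num
    · norm_num
  refine final (a := 0.0005) (b := 0.00002) (w := 0.0354) (g := 0.0056) (κ := 0.0524) (l := 0.051) (V := 0.1515)
    (L0 := 21.78) (X := 2900000000) (by norm_num) (by norm_num) ab2 (by norm_num) (by norm_num) hk (by norm_num) hL (by norm_num)
    hTT (by norm_num) (by norm_num) (by norm_num) ?_ ?_ (by norm_num) (by norm_num)
  · intro e he1 he2
    have he3 : e ≤ 0.1057 := by norm_num at he2; linarith
    refine ⟨(log_lower he1 (by linarith)).2 he3, ?_⟩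
    rw [abs_le]; constructor <;> linarith
  · refine le_trans ?_ (Real.le_log_one_add_of_nonneg (by norm_num))
    norm_num

end RobinAux


namespace RobinAux

def QQ : ℕ := 5397346292805549782720214077673687806275517530364350655459511599582614290

def compB (m : ℕ) : Bool :=
  (Nat.blt 3 m && !(Nat.beq (Nat.gcd m 6) 1)) || ((Nat.blt 13 m && !(Nat.beq (Nat.gcd m 30030) 1)) ||
    (Nat.blt 181 m && !(Nat.beq (Nat.gcd m QQ) 1)))

def crB : ℕ → ℕ → Bool
  | 0, _ => true
  | n + 1, m => compB m && crB n (m + 1)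

def chkB : ℕ → List ℕ → Bool
  | _, [] => true
  | a, b :: t => (Nat.blt a b && crB (b - a - 1) (a + 1)) && chkB b t

def lastB : ℕ → List ℕ → ℕ
  | a, [] => a
  | _, b :: t => lastB b t

def chkL : ℕ → List (List ℕ) → Bool
  | _, [] => true
  | a, c :: t => chkB a c && chkL (lastB a c) t

def plB (f : ℕ → ℕ) : List ℕ → ℕ → ℕ
  | [], _ => 1
  | _ :: _, 0 => 1
  | p :: t, k + 1 => f p * plB f t k

def pllB (f : ℕ → ℕ) : List (List ℕ) → ℕ → ℕ
  | [], _ => 1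
  | c :: t, k => plB f c k * pllB f t (k - 439)

def ch1 : List ℕ := [
  2, 3, 5, 7, 11, 13, 17, 19, 23, 29, 31, 37, 41, 43, 47, 53, 59, 61,
  67, 71, 73, 79, 83, 89, 97, 101, 103, 107, 109, 113, 127, 131, 137, 139, 149, 151,
  157, 163, 167, 173, 179, 181, 191, 193, 197, 199, 211, 223, 227, 229, 233, 239, 241, 251,
  257, 263, 269, 271, 277, 281, 283, 293, 307, 311, 313, 317, 331, 337, 347, 349, 353, 359,
  367, 373, 379, 383, 389, 397, 401, 409, 419, 421, 431, 433, 439, 443, 449, 457, 461, 463,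
  467, 479, 487, 491, 499, 503, 509, 521, 523, 541, 547, 557, 563, 569, 571, 577, 587, 593,
  599, 601, 607, 613, 617, 619, 631, 641, 643, 647, 653, 659, 661, 673, 677, 683, 691, 701,
  709, 719, 727, 733, 739, 743, 751, 757, 761, 769, 773, 787, 797, 809, 811, 821, 823, 827,
  829, 839, 853, 857, 859, 863, 877, 881, 883, 887, 907, 911, 919, 929, 937, 941, 947, 953,
  967, 971, 977, 983, 991, 997, 1009, 1013, 1019, 1021, 1031, 1033, 1039, 1049, 1051, 1061, 1063, 1069,
  1087, 1091, 1093, 1097, 1103, 1109, 1117, 1123, 1129, 1151, 1153, 1163, 1171, 1181, 1187, 1193, 1201, 1213,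
  1217, 1223, 1229, 1231, 1237, 1249, 1259, 1277, 1279, 1283, 1289, 1291, 1297, 1301, 1303, 1307, 1319, 1321,
  1327, 1361, 1367, 1373, 1381, 1399, 1409, 1423, 1427, 1429, 1433, 1439, 1447, 1451, 1453, 1459, 1471, 1481,
  1483, 1487, 1489, 1493, 1499, 1511, 1523, 1531, 1543, 1549, 1553, 1559, 1567, 1571, 1579, 1583, 1597, 1601,
  1607, 1609, 1613, 1619, 1621, 1627, 1637, 1657, 1663, 1667, 1669, 1693, 1697, 1699, 1709, 1721, 1723, 1733,
  1741, 1747, 1753, 1759, 1777, 1783, 1787, 1789, 1801, 1811, 1823, 1831, 1847, 1861, 1867, 1871, 1873, 1877,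
  1879, 1889, 1901, 1907, 1913, 1931, 1933, 1949, 1951, 1973, 1979, 1987, 1993, 1997, 1999, 2003, 2011, 2017,
  2027, 2029, 2039, 2053, 2063, 2069, 2081, 2083, 2087, 2089, 2099, 2111, 2113, 2129, 2131, 2137, 2141, 2143,
  2153, 2161, 2179, 2203, 2207, 2213, 2221, 2237, 2239, 2243, 2251, 2267, 2269, 2273, 2281, 2287, 2293, 2297,
  2309, 2311, 2333, 2339, 2341, 2347, 2351, 2357, 2371, 2377, 2381, 2383, 2389, 2393, 2399, 2411, 2417, 2423,
  2437, 2441, 2447, 2459, 2467, 2473, 2477, 2503, 2521, 2531, 2539, 2543, 2549, 2551, 2557, 2579, 2591, 2593,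
  2609, 2617, 2621, 2633, 2647, 2657, 2659, 2663, 2671, 2677, 2683, 2687, 2689, 2693, 2699, 2707, 2711, 2713,
  2719, 2729, 2731, 2741, 2749, 2753, 2767, 2777, 2789, 2791, 2797, 2801, 2803, 2819, 2833, 2837, 2843, 2851,
  2857, 2861, 2879, 2887, 2897, 2903, 2909, 2917, 2927, 2939, 2953, 2957, 2963, 2969, 2971, 2999, 3001, 3011,
  3019, 3023, 3037, 3041, 3049, 3061, 3067]

def ch2 : List ℕ := [
  3079, 3083, 3089, 3109, 3119, 3121, 3137, 3163, 3167, 3169, 3181, 3187, 3191, 3203, 3209, 3217, 3221, 3229,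
  3251, 3253, 3257, 3259, 3271, 3299, 3301, 3307, 3313, 3319, 3323, 3329, 3331, 3343, 3347, 3359, 3361, 3371,
  3373, 3389, 3391, 3407, 3413, 3433, 3449, 3457, 3461, 3463, 3467, 3469, 3491, 3499, 3511, 3517, 3527, 3529,
  3533, 3539, 3541, 3547, 3557, 3559, 3571, 3581, 3583, 3593, 3607, 3613, 3617, 3623, 3631, 3637, 3643, 3659,
  3671, 3673, 3677, 3691, 3697, 3701, 3709, 3719, 3727, 3733, 3739, 3761, 3767, 3769, 3779, 3793, 3797, 3803,
  3821, 3823, 3833, 3847, 3851, 3853, 3863, 3877, 3881, 3889, 3907, 3911, 3917, 3919, 3923, 3929, 3931, 3943,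
  3947, 3967, 3989, 4001, 4003, 4007, 4013, 4019, 4021, 4027, 4049, 4051, 4057, 4073, 4079, 4091, 4093, 4099,
  4111, 4127, 4129, 4133, 4139, 4153, 4157, 4159, 4177, 4201, 4211, 4217, 4219, 4229, 4231, 4241, 4243, 4253,
  4259, 4261, 4271, 4273, 4283, 4289, 4297, 4327, 4337, 4339, 4349, 4357, 4363, 4373, 4391, 4397, 4409, 4421,
  4423, 4441, 4447, 4451, 4457, 4463, 4481, 4483, 4493, 4507, 4513, 4517, 4519, 4523, 4547, 4549, 4561, 4567,
  4583, 4591, 4597, 4603, 4621, 4637, 4639, 4643, 4649, 4651, 4657, 4663, 4673, 4679, 4691, 4703, 4721, 4723,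
  4729, 4733, 4751, 4759, 4783, 4787, 4789, 4793, 4799, 4801, 4813, 4817, 4831, 4861, 4871, 4877, 4889, 4903,
  4909, 4919, 4931, 4933, 4937, 4943, 4951, 4957, 4967, 4969, 4973, 4987, 4993, 4999, 5003, 5009, 5011, 5021,
  5023, 5039, 5051, 5059, 5077, 5081, 5087, 5099, 5101, 5107, 5113, 5119, 5147, 5153, 5167, 5171, 5179, 5189,
  5197, 5209, 5227, 5231, 5233, 5237, 5261, 5273, 5279, 5281, 5297, 5303, 5309, 5323, 5333, 5347, 5351, 5381,
  5387, 5393, 5399, 5407, 5413, 5417, 5419, 5431, 5437, 5441, 5443, 5449, 5471, 5477, 5479, 5483, 5501, 5503,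
  5507, 5519, 5521, 5527, 5531, 5557, 5563, 5569, 5573, 5581, 5591, 5623, 5639, 5641, 5647, 5651, 5653, 5657,
  5659, 5669, 5683, 5689, 5693, 5701, 5711, 5717, 5737, 5741, 5743, 5749, 5779, 5783, 5791, 5801, 5807, 5813,
  5821, 5827, 5839, 5843, 5849, 5851, 5857, 5861, 5867, 5869, 5879, 5881, 5897, 5903, 5923, 5927, 5939, 5953,
  5981, 5987, 6007, 6011, 6029, 6037, 6043, 6047, 6053, 6067, 6073, 6079, 6089, 6091, 6101, 6113, 6121, 6131,
  6133, 6143, 6151, 6163, 6173, 6197, 6199, 6203, 6211, 6217, 6221, 6229, 6247, 6257, 6263, 6269, 6271, 6277,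
  6287, 6299, 6301, 6311, 6317, 6323, 6329, 6337, 6343, 6353, 6359, 6361, 6367, 6373, 6379, 6389, 6397, 6421,
  6427, 6449, 6451, 6469, 6473, 6481, 6491, 6521, 6529, 6547, 6551, 6553, 6563, 6569, 6571, 6577, 6581, 6599,
  6607, 6619, 6637, 6653, 6659, 6661, 6673, 6679, 6689, 6691, 6701, 6703, 6709, 6719, 6733, 6737, 6761, 6763,
  6779, 6781, 6791, 6793, 6803, 6823, 6827]

def ch3 : List ℕ := [
  6829, 6833, 6841, 6857, 6863, 6869, 6871, 6883, 6899, 6907, 6911, 6917, 6947, 6949, 6959, 6961, 6967, 6971,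
  6977, 6983, 6991, 6997, 7001, 7013, 7019, 7027, 7039, 7043, 7057, 7069, 7079, 7103, 7109, 7121, 7127, 7129,
  7151, 7159, 7177, 7187, 7193, 7207, 7211, 7213, 7219, 7229, 7237, 7243, 7247, 7253, 7283, 7297, 7307, 7309,
  7321, 7331, 7333, 7349, 7351, 7369, 7393, 7411, 7417, 7433, 7451, 7457, 7459, 7477, 7481, 7487, 7489, 7499,
  7507, 7517, 7523, 7529, 7537, 7541, 7547, 7549, 7559, 7561, 7573, 7577, 7583, 7589, 7591, 7603, 7607, 7621,
  7639, 7643, 7649, 7669, 7673, 7681, 7687, 7691, 7699, 7703, 7717, 7723, 7727, 7741, 7753, 7757, 7759, 7789,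
  7793, 7817, 7823, 7829, 7841, 7853, 7867, 7873, 7877, 7879, 7883, 7901, 7907, 7919, 7927, 7933, 7937, 7949,
  7951, 7963, 7993, 8009, 8011, 8017, 8039, 8053, 8059, 8069, 8081, 8087, 8089, 8093, 8101, 8111, 8117, 8123,
  8147, 8161, 8167, 8171, 8179, 8191, 8209, 8219, 8221, 8231, 8233, 8237, 8243, 8263, 8269, 8273, 8287, 8291,
  8293, 8297, 8311, 8317, 8329, 8353, 8363, 8369, 8377, 8387, 8389, 8419, 8423, 8429, 8431, 8443, 8447, 8461,
  8467, 8501, 8513, 8521, 8527, 8537, 8539, 8543, 8563, 8573, 8581, 8597, 8599, 8609, 8623, 8627, 8629, 8641,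
  8647, 8663, 8669, 8677, 8681, 8689, 8693, 8699, 8707, 8713, 8719, 8731, 8737, 8741, 8747, 8753, 8761, 8779,
  8783, 8803, 8807, 8819, 8821, 8831, 8837, 8839, 8849, 8861, 8863, 8867, 8887, 8893, 8923, 8929, 8933, 8941,
  8951, 8963, 8969, 8971, 8999, 9001, 9007, 9011, 9013, 9029, 9041, 9043, 9049, 9059, 9067, 9091, 9103, 9109,
  9127, 9133, 9137, 9151, 9157, 9161, 9173, 9181, 9187, 9199, 9203, 9209, 9221, 9227, 9239, 9241, 9257, 9277,
  9281, 9283, 9293, 9311, 9319, 9323, 9337, 9341, 9343, 9349, 9371, 9377, 9391, 9397, 9403, 9413, 9419, 9421,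
  9431, 9433, 9437, 9439, 9461, 9463, 9467, 9473, 9479, 9491, 9497, 9511, 9521, 9533, 9539, 9547, 9551, 9587,
  9601, 9613, 9619, 9623, 9629, 9631, 9643, 9649, 9661, 9677, 9679, 9689, 9697, 9719, 9721, 9733, 9739, 9743,
  9749, 9767, 9769, 9781, 9787, 9791, 9803, 9811, 9817, 9829, 9833, 9839, 9851, 9857, 9859, 9871, 9883, 9887,
  9901, 9907, 9923, 9929, 9931, 9941, 9949, 9967, 9973, 10007, 10009, 10037, 10039, 10061, 10067, 10069, 10079, 10091,
  10093, 10099, 10103, 10111, 10133, 10139, 10141, 10151, 10159, 10163, 10169, 10177, 10181, 10193, 10211, 10223, 10243, 10247,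
  10253, 10259, 10267, 10271, 10273, 10289, 10301, 10303, 10313, 10321, 10331, 10333, 10337, 10343, 10357, 10369, 10391, 10399,
  10427, 10429, 10433, 10453, 10457, 10459, 10463, 10477, 10487, 10499, 10501, 10513, 10529, 10531, 10559, 10567, 10589, 10597,
  10601, 10607, 10613, 10627, 10631, 10639, 10651, 10657, 10663, 10667, 10687, 10691, 10709, 10711, 10723, 10729, 10733, 10739,
  10753, 10771, 10781, 10789, 10799, 10831, 10837]

def ch4 : List ℕ := [
  10847, 10853, 10859, 10861, 10867, 10883, 10889, 10891, 10903, 10909, 10937, 10939, 10949, 10957, 10973, 10979, 10987, 10993,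
  11003, 11027, 11047, 11057, 11059, 11069, 11071, 11083, 11087, 11093, 11113, 11117, 11119, 11131, 11149, 11159, 11161, 11171,
  11173, 11177, 11197, 11213, 11239, 11243, 11251, 11257, 11261, 11273, 11279, 11287, 11299, 11311, 11317, 11321, 11329, 11351,
  11353, 11369, 11383, 11393, 11399, 11411, 11423, 11437, 11443, 11447, 11467, 11471, 11483, 11489, 11491, 11497, 11503, 11519,
  11527, 11549, 11551, 11579, 11587, 11593, 11597, 11617, 11621, 11633, 11657, 11677, 11681, 11689, 11699, 11701, 11717, 11719,
  11731, 11743, 11777, 11779, 11783, 11789, 11801, 11807, 11813, 11821, 11827, 11831, 11833, 11839, 11863, 11867, 11887, 11897,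
  11903, 11909, 11923, 11927, 11933, 11939, 11941, 11953, 11959, 11969, 11971, 11981, 11987, 12007, 12011, 12037, 12041, 12043,
  12049, 12071, 12073, 12097, 12101, 12107, 12109, 12113, 12119, 12143, 12149, 12157, 12161, 12163, 12197, 12203, 12211, 12227,
  12239, 12241, 12251, 12253, 12263, 12269, 12277, 12281, 12289, 12301, 12323, 12329, 12343, 12347, 12373, 12377, 12379, 12391,
  12401, 12409, 12413, 12421, 12433, 12437, 12451, 12457, 12473, 12479, 12487, 12491, 12497, 12503, 12511, 12517, 12527, 12539,
  12541, 12547, 12553, 12569, 12577, 12583, 12589, 12601, 12611, 12613, 12619, 12637, 12641, 12647, 12653, 12659, 12671, 12689,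
  12697, 12703, 12713, 12721, 12739, 12743, 12757, 12763, 12781, 12791, 12799, 12809, 12821, 12823, 12829, 12841, 12853, 12889,
  12893, 12899, 12907, 12911, 12917, 12919, 12923, 12941, 12953, 12959, 12967, 12973, 12979, 12983, 13001, 13003, 13007, 13009,
  13033, 13037, 13043, 13049, 13063, 13093, 13099, 13103, 13109, 13121, 13127, 13147, 13151, 13159, 13163, 13171, 13177, 13183,
  13187, 13217, 13219, 13229, 13241, 13249, 13259, 13267, 13291, 13297, 13309, 13313, 13327, 13331, 13337, 13339, 13367, 13381,
  13397, 13399, 13411, 13417, 13421, 13441, 13451, 13457, 13463, 13469, 13477, 13487, 13499, 13513, 13523, 13537, 13553, 13567,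
  13577, 13591, 13597, 13613, 13619, 13627, 13633, 13649, 13669, 13679, 13681, 13687, 13691, 13693, 13697, 13709, 13711, 13721,
  13723, 13729, 13751, 13757, 13759, 13763, 13781, 13789, 13799, 13807, 13829, 13831, 13841, 13859, 13873, 13877, 13879, 13883,
  13901, 13903, 13907, 13913, 13921, 13931, 13933, 13963, 13967, 13997, 13999, 14009, 14011, 14029, 14033, 14051, 14057, 14071,
  14081, 14083, 14087, 14107, 14143, 14149, 14153, 14159, 14173, 14177, 14197, 14207, 14221, 14243, 14249, 14251, 14281, 14293,
  14303, 14321, 14323, 14327, 14341, 14347, 14369, 14387, 14389, 14401, 14407, 14411, 14419, 14423, 14431, 14437, 14447, 14449,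
  14461, 14479, 14489, 14503, 14519, 14533, 14537, 14543, 14549, 14551, 14557, 14561, 14563, 14591, 14593, 14621, 14627, 14629,
  14633, 14639, 14653, 14657, 14669, 14683, 14699, 14713, 14717, 14723, 14731, 14737, 14741, 14747, 14753, 14759, 14767, 14771,
  14779, 14783, 14797, 14813, 14821, 14827, 14831, 14843, 14851, 14867, 14869, 14879, 14887, 14891, 14897, 14923, 14929, 14939,
  14947, 14951, 14957, 14969, 14983, 15013, 15017]

def ch5 : List ℕ := [
  15031, 15053, 15061, 15073, 15077, 15083, 15091, 15101, 15107, 15121, 15131, 15137, 15139, 15149, 15161, 15173, 15187, 15193,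
  15199, 15217, 15227, 15233, 15241, 15259, 15263, 15269, 15271, 15277, 15287, 15289, 15299, 15307, 15313, 15319, 15329, 15331,
  15349, 15359, 15361, 15373, 15377, 15383, 15391, 15401, 15413, 15427, 15439, 15443, 15451, 15461, 15467, 15473, 15493, 15497,
  15511, 15527, 15541, 15551, 15559, 15569, 15581, 15583, 15601, 15607, 15619, 15629, 15641, 15643, 15647, 15649, 15661, 15667,
  15671, 15679, 15683, 15727, 15731, 15733, 15737, 15739, 15749, 15761, 15767, 15773, 15787, 15791, 15797, 15803, 15809, 15817,
  15823, 15859, 15877, 15881, 15887, 15889, 15901, 15907, 15913, 15919, 15923, 15937, 15959, 15971, 15973, 15991, 16001, 16007,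
  16033, 16057, 16061, 16063, 16067, 16069, 16073, 16087, 16091, 16097, 16103, 16111, 16127, 16139, 16141, 16183, 16187, 16189,
  16193, 16217, 16223, 16229, 16231, 16249, 16253, 16267, 16273, 16301, 16319, 16333, 16339, 16349, 16361, 16363, 16369, 16381,
  16411, 16417, 16421, 16427, 16433, 16447, 16451, 16453, 16477, 16481, 16487, 16493, 16519, 16529, 16547, 16553, 16561, 16567,
  16573, 16603, 16607, 16619, 16631, 16633, 16649, 16651, 16657, 16661, 16673, 16691, 16693, 16699, 16703, 16729, 16741, 16747,
  16759, 16763, 16787, 16811, 16823, 16829, 16831, 16843, 16871, 16879, 16883, 16889, 16901, 16903, 16921, 16927, 16931, 16937,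
  16943, 16963, 16979, 16981, 16987, 16993, 17011, 17021, 17027, 17029, 17033, 17041, 17047, 17053, 17077, 17093, 17099, 17107,
  17117, 17123, 17137, 17159, 17167, 17183, 17189, 17191, 17203, 17207, 17209, 17231, 17239, 17257, 17291, 17293, 17299, 17317,
  17321, 17327, 17333, 17341, 17351, 17359, 17377, 17383, 17387, 17389, 17393, 17401, 17417, 17419, 17431, 17443, 17449, 17467,
  17471, 17477, 17483, 17489, 17491, 17497, 17509, 17519, 17539, 17551, 17569, 17573, 17579, 17581, 17597, 17599, 17609, 17623,
  17627, 17657, 17659, 17669, 17681, 17683, 17707, 17713, 17729, 17737, 17747, 17749, 17761, 17783, 17789, 17791, 17807, 17827,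
  17837, 17839, 17851, 17863, 17881, 17891, 17903, 17909, 17911, 17921, 17923, 17929, 17939, 17957, 17959, 17971, 17977, 17981,
  17987, 17989, 18013, 18041, 18043, 18047, 18049, 18059, 18061, 18077, 18089, 18097, 18119, 18121, 18127, 18131, 18133, 18143,
  18149, 18169, 18181, 18191, 18199, 18211, 18217, 18223, 18229, 18233, 18251, 18253, 18257, 18269, 18287, 18289, 18301, 18307,
  18311, 18313, 18329, 18341, 18353, 18367, 18371, 18379, 18397, 18401, 18413, 18427, 18433, 18439, 18443, 18451, 18457, 18461,
  18481, 18493, 18503, 18517, 18521, 18523, 18539, 18541, 18553, 18583, 18587, 18593, 18617, 18637, 18661, 18671, 18679, 18691,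
  18701, 18713, 18719, 18731, 18743, 18749, 18757, 18773, 18787, 18793, 18797, 18803, 18839, 18859, 18869, 18899, 18911, 18913,
  18917, 18919, 18947, 18959, 18973, 18979, 19001, 19009, 19013, 19031, 19037, 19051, 19069, 19073, 19079, 19081, 19087, 19121,
  19139, 19141, 19157, 19163, 19181, 19183, 19207, 19211, 19213, 19219, 19231, 19237, 19249, 19259, 19267, 19273, 19289, 19301,
  19309, 19319, 19333, 19373, 19379, 19381, 19387]

def ch6 : List ℕ := [
  19391, 19403, 19417, 19421, 19423, 19427, 19429, 19433, 19441, 19447, 19457, 19463, 19469, 19471, 19477, 19483, 19489, 19501,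
  19507, 19531, 19541, 19543, 19553, 19559, 19571, 19577, 19583, 19597, 19603, 19609, 19661, 19681, 19687, 19697, 19699, 19709,
  19717, 19727, 19739, 19751, 19753, 19759, 19763, 19777, 19793, 19801, 19813, 19819, 19841, 19843, 19853, 19861, 19867, 19889,
  19891, 19913, 19919, 19927, 19937, 19949, 19961, 19963, 19973, 19979, 19991, 19993, 19997, 20011, 20021, 20023, 20029, 20047,
  20051, 20063, 20071, 20089, 20101, 20107, 20113, 20117, 20123, 20129, 20143, 20147, 20149, 20161, 20173, 20177, 20183, 20201,
  20219, 20231, 20233, 20249, 20261, 20269, 20287, 20297, 20323, 20327, 20333, 20341, 20347, 20353, 20357, 20359, 20369, 20389,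
  20393, 20399, 20407, 20411, 20431, 20441, 20443, 20477, 20479, 20483, 20507, 20509, 20521, 20533, 20543, 20549, 20551, 20563,
  20593, 20599, 20611, 20627, 20639, 20641, 20663, 20681, 20693, 20707, 20717, 20719, 20731, 20743, 20747, 20749, 20753, 20759,
  20771, 20773, 20789, 20807, 20809, 20849, 20857, 20873, 20879, 20887, 20897, 20899, 20903, 20921, 20929, 20939, 20947, 20959,
  20963, 20981, 20983, 21001, 21011, 21013, 21017, 21019, 21023, 21031, 21059, 21061, 21067, 21089, 21101, 21107, 21121, 21139,
  21143, 21149, 21157, 21163, 21169, 21179, 21187, 21191, 21193, 21211, 21221, 21227, 21247, 21269, 21277, 21283, 21313, 21317,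
  21319, 21323, 21341, 21347, 21377, 21379, 21383, 21391, 21397, 21401, 21407, 21419, 21433, 21467, 21481, 21487, 21491, 21493,
  21499, 21503, 21517, 21521, 21523, 21529, 21557, 21559, 21563, 21569, 21577, 21587, 21589, 21599, 21601, 21611, 21613, 21617,
  21647, 21649, 21661, 21673, 21683, 21701, 21713, 21727, 21737, 21739, 21751, 21757, 21767, 21773, 21787, 21799, 21803, 21817,
  21821, 21839, 21841, 21851, 21859, 21863, 21871, 21881, 21893, 21911, 21929, 21937, 21943, 21961, 21977, 21991, 21997, 22003,
  22013, 22027, 22031, 22037, 22039, 22051, 22063, 22067, 22073, 22079, 22091, 22093, 22109, 22111, 22123, 22129, 22133, 22147,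
  22153, 22157, 22159, 22171, 22189, 22193, 22229, 22247, 22259, 22271, 22273, 22277, 22279, 22283, 22291, 22303, 22307, 22343,
  22349, 22367, 22369, 22381, 22391, 22397, 22409, 22433, 22441, 22447, 22453, 22469, 22481, 22483, 22501, 22511, 22531, 22541,
  22543, 22549, 22567, 22571, 22573, 22613, 22619, 22621, 22637, 22639, 22643, 22651, 22669, 22679, 22691, 22697, 22699, 22709,
  22717, 22721, 22727, 22739, 22741, 22751, 22769, 22777, 22783, 22787, 22807, 22811, 22817, 22853, 22859, 22861, 22871, 22877,
  22901, 22907, 22921, 22937, 22943, 22961, 22963, 22973, 22993, 23003, 23011, 23017, 23021, 23027, 23029, 23039, 23041, 23053,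
  23057, 23059, 23063, 23071, 23081, 23087, 23099, 23117, 23131, 23143, 23159, 23167, 23173, 23189, 23197, 23201, 23203, 23209,
  23227, 23251, 23269, 23279, 23291, 23293, 23297, 23311, 23321, 23327, 23333, 23339, 23357, 23369, 23371, 23399, 23417, 23431,
  23447, 23459, 23473, 23497, 23509, 23531, 23537, 23539, 23549, 23557, 23561, 23563, 23567, 23581, 23593, 23599, 23603, 23609,
  23623, 23627, 23629, 23633, 23663, 23669, 23671]

def ch7 : List ℕ := [
  23677, 23687, 23689, 23719, 23741, 23743, 23747, 23753, 23761, 23767, 23773, 23789, 23801, 23813, 23819, 23827, 23831, 23833,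
  23857, 23869, 23873, 23879, 23887, 23893, 23899, 23909, 23911, 23917, 23929, 23957, 23971, 23977, 23981, 23993, 24001, 24007,
  24019, 24023, 24029, 24043, 24049, 24061, 24071, 24077, 24083, 24091, 24097, 24103, 24107, 24109, 24113, 24121, 24133, 24137,
  24151, 24169, 24179, 24181, 24197, 24203, 24223, 24229, 24239, 24247, 24251, 24281, 24317, 24329, 24337, 24359, 24371, 24373,
  24379, 24391, 24407, 24413, 24419, 24421, 24439, 24443, 24469, 24473, 24481, 24499, 24509, 24517, 24527, 24533, 24547, 24551,
  24571, 24593, 24611, 24623, 24631, 24659, 24671, 24677, 24683, 24691, 24697, 24709, 24733, 24749, 24763, 24767, 24781, 24793,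
  24799, 24809, 24821, 24841, 24847, 24851, 24859, 24877, 24889, 24907, 24917, 24919, 24923, 24943, 24953, 24967, 24971, 24977,
  24979, 24989, 25013, 25031, 25033, 25037, 25057, 25073, 25087, 25097, 25111, 25117, 25121, 25127, 25147, 25153, 25163, 25169,
  25171, 25183, 25189, 25219, 25229, 25237, 25243, 25247, 25253, 25261, 25301, 25303, 25307, 25309, 25321, 25339, 25343, 25349,
  25357, 25367, 25373, 25391, 25409, 25411, 25423, 25439, 25447, 25453, 25457, 25463, 25469, 25471, 25523, 25537, 25541, 25561,
  25577, 25579, 25583, 25589, 25601, 25603, 25609, 25621, 25633, 25639, 25643, 25657, 25667, 25673, 25679, 25693, 25703, 25717,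
  25733, 25741, 25747, 25759, 25763, 25771, 25793, 25799, 25801, 25819, 25841, 25847, 25849, 25867, 25873, 25889, 25903, 25913,
  25919, 25931, 25933, 25939, 25943, 25951, 25969, 25981, 25997, 25999, 26003, 26017, 26021, 26029, 26041, 26053, 26083, 26099,
  26107, 26111, 26113, 26119, 26141, 26153, 26161, 26171, 26177, 26183, 26189, 26203, 26209, 26227, 26237, 26249, 26251, 26261,
  26263, 26267, 26293, 26297, 26309, 26317, 26321, 26339, 26347, 26357, 26371, 26387, 26393, 26399, 26407, 26417, 26423, 26431,
  26437, 26449, 26459, 26479, 26489, 26497, 26501, 26513, 26539, 26557, 26561, 26573, 26591, 26597, 26627, 26633, 26641, 26647,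
  26669, 26681, 26683, 26687, 26693, 26699, 26701, 26711, 26713, 26717, 26723, 26729, 26731, 26737, 26759, 26777, 26783, 26801,
  26813, 26821, 26833, 26839, 26849, 26861, 26863, 26879, 26881, 26891, 26893, 26903, 26921, 26927, 26947, 26951, 26953, 26959,
  26981, 26987, 26993, 27011, 27017, 27031, 27043, 27059, 27061, 27067, 27073, 27077, 27091, 27103, 27107, 27109, 27127, 27143,
  27179, 27191, 27197, 27211, 27239, 27241, 27253, 27259, 27271, 27277, 27281, 27283, 27299, 27329, 27337, 27361, 27367, 27397,
  27407, 27409, 27427, 27431, 27437, 27449, 27457, 27479, 27481, 27487, 27509, 27527, 27529, 27539, 27541, 27551, 27581, 27583,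
  27611, 27617, 27631, 27647, 27653, 27673, 27689, 27691, 27697, 27701, 27733, 27737, 27739, 27743, 27749, 27751, 27763, 27767,
  27773, 27779, 27791, 27793, 27799, 27803, 27809, 27817, 27823, 27827, 27847, 27851, 27883, 27893, 27901, 27917, 27919, 27941,
  27943, 27947, 27953, 27961, 27967, 27983, 27997, 28001, 28019, 28027, 28031, 28051, 28057, 28069, 28081, 28087, 28097, 28099,
  28109, 28111, 28123, 28151, 28163, 28181, 28183]

def ch8 : List ℕ := [
  28201, 28211, 28219, 28229, 28277, 28279, 28283, 28289, 28297, 28307, 28309, 28319, 28349, 28351, 28387, 28393, 28403, 28409,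
  28411, 28429, 28433, 28439, 28447, 28463, 28477, 28493, 28499, 28513, 28517, 28537, 28541, 28547, 28549, 28559, 28571, 28573,
  28579, 28591, 28597, 28603, 28607, 28619, 28621, 28627, 28631, 28643, 28649, 28657, 28661, 28663, 28669, 28687, 28697, 28703,
  28711, 28723, 28729, 28751, 28753, 28759, 28771, 28789, 28793, 28807, 28813, 28817, 28837, 28843, 28859, 28867, 28871, 28879,
  28901, 28909, 28921, 28927, 28933, 28949, 28961, 28979, 29009, 29017, 29021, 29023, 29027, 29033, 29059, 29063, 29077, 29101,
  29123, 29129, 29131, 29137, 29147, 29153, 29167, 29173, 29179, 29191, 29201, 29207, 29209, 29221, 29231, 29243, 29251, 29269,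
  29287, 29297, 29303, 29311, 29327, 29333, 29339, 29347, 29363, 29383, 29387, 29389, 29399, 29401, 29411, 29423, 29429, 29437,
  29443, 29453, 29473, 29483, 29501, 29527, 29531, 29537, 29567, 29569, 29573, 29581, 29587, 29599, 29611, 29629, 29633, 29641,
  29663, 29669, 29671, 29683, 29717, 29723, 29741, 29753, 29759, 29761, 29789, 29803, 29819, 29833, 29837, 29851, 29863, 29867,
  29873, 29879, 29881, 29917, 29921, 29927, 29947, 29959, 29983, 29989, 30011, 30013, 30029, 30047, 30059, 30071, 30089, 30091,
  30097, 30103, 30109, 30113, 30119, 30133, 30137, 30139, 30161, 30169, 30181, 30187, 30197, 30203, 30211, 30223, 30241, 30253,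
  30259, 30269, 30271, 30293, 30307, 30313, 30319, 30323, 30341, 30347, 30367, 30389, 30391, 30403, 30427, 30431, 30449, 30467,
  30469, 30491, 30493, 30497, 30509, 30517, 30529, 30539, 30553, 30557, 30559, 30577, 30593, 30631, 30637, 30643, 30649, 30661,
  30671, 30677, 30689, 30697, 30703, 30707, 30713, 30727, 30757, 30763, 30773, 30781, 30803, 30809, 30817, 30829, 30839, 30841,
  30851, 30853, 30859, 30869, 30871, 30881, 30893, 30911, 30931, 30937, 30941, 30949, 30971, 30977, 30983, 31013, 31019, 31033,
  31039, 31051, 31063, 31069, 31079, 31081, 31091, 31121, 31123, 31139, 31147, 31151, 31153, 31159, 31177, 31181, 31183, 31189,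
  31193, 31219, 31223, 31231, 31237, 31247, 31249, 31253, 31259, 31267, 31271, 31277, 31307, 31319, 31321, 31327, 31333, 31337,
  31357, 31379, 31387, 31391, 31393, 31397, 31469, 31477, 31481, 31489, 31511, 31513, 31517, 31531, 31541, 31543, 31547, 31567,
  31573, 31583, 31601, 31607, 31627, 31643, 31649, 31657, 31663, 31667, 31687, 31699, 31721, 31723, 31727, 31729, 31741, 31751,
  31769, 31771, 31793, 31799, 31817, 31847, 31849, 31859, 31873, 31883, 31891, 31907, 31957, 31963, 31973, 31981, 31991, 32003,
  32009, 32027, 32029, 32051, 32057, 32059, 32063, 32069, 32077, 32083, 32089, 32099, 32117, 32119, 32141, 32143, 32159, 32173,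
  32183, 32189, 32191, 32203, 32213, 32233, 32237, 32251, 32257, 32261, 32297, 32299, 32303, 32309, 32321, 32323, 32327, 32341,
  32353, 32359, 32363, 32369, 32371, 32377, 32381, 32401, 32411, 32413, 32423, 32429, 32441, 32443, 32467, 32479, 32491, 32497,
  32503, 32507, 32531, 32533, 32537, 32561, 32563, 32569, 32573, 32579, 32587, 32603, 32609, 32611, 32621, 32633, 32647, 32653,
  32687, 32693, 32707, 32713, 32717, 32719, 32749]

def chs : List (List ℕ) := [ch1, ch2, ch3, ch4, ch5, ch6, ch7, ch8]

def blkB (b : ℕ × ℕ × ℕ × ℕ × ℕ) : Bool :=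
  Nat.ble (2 ^ b.2.2.2.1) ((pllB (fun p => p) chs b.1 * pllB (fun p => p) chs b.2.2.1) ^ 8) &&
  (Nat.ble (pllB (fun p => p) chs b.2.1 * 1024000) (1781 * b.2.2.2.2 * pllB (fun p => p - 1) chs b.2.1) &&
   Nat.blt (1074790913 ^ b.2.2.2.2 * 80000) (6931 * b.2.2.2.1 * 2 ^ (30 * b.2.2.2.2)))

def blocks2 : List (ℕ × ℕ × ℕ × ℕ × ℕ) := [
  (18, 18, 9, 834, 4370), (19, 19, 10, 922, 4436), (20, 20, 10, 971, 4499), (21, 22, 11, 1060, 4620),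
  (23, 24, 12, 1203, 4730), (25, 27, 13, 1351, 4874), (28, 30, 14, 1555, 5010), (31, 34, 16, 1810, 5163),
  (35, 38, 18, 2132, 5299)]

def blocks3 : List (ℕ × ℕ × ℕ × ℕ × ℕ) := [
  (39, 39, 13, 2138, 5331), (40, 41, 14, 2241, 5392), (42, 42, 14, 2361, 5422), (43, 44, 15, 2466, 5479),
  (45, 46, 15, 2587, 5535), (47, 48, 16, 2756, 5586), (49, 51, 17, 2928, 5660), (52, 54, 18, 3165, 5730),
  (55, 58, 19, 3404, 5817), (59, 62, 20, 3712, 5900), (63, 67, 21, 4023, 5994), (68, 73, 23, 4458, 6098),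
  (74, 80, 25, 4970, 6208), (81, 88, 27, 5560, 6323), (89, 97, 30, 6285, 6442), (98, 108, 33, 7097, 6571),
  (109, 121, 37, 8133, 6708), (122, 136, 41, 9338, 6849), (137, 154, 46, 10783, 6998), (155, 176, 52, 12558, 7157),
  (177, 202, 59, 14758, 7323), (203, 234, 68, 17468, 7497), (235, 272, 79, 20886, 7677), (273, 318, 91, 24969, 7862),
  (319, 374, 107, 30148, 8054), (375, 442, 125, 36503, 8251), (443, 526, 148, 44507, 8455), (527, 629, 176, 54623, 8664),
  (630, 756, 210, 67318, 8879), (757, 913, 253, 83477, 9099), (914, 1107, 305, 103868, 9323), (1108, 1348, 370, 129791, 9551),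
  (1349, 1648, 450, 162744, 9783), (1649, 2021, 550, 204860, 10018), (2022, 2489, 674, 258505, 10257), (2490, 3074, 830, 327542, 10499),
  (3075, 3512, 1025, 415961, 10652)]

set_option maxRecDepth 100000 in
lemma chk_ok : chkL 1 (chs ++ [[32768]]) = true := by decide +kernel

set_option maxRecDepth 100000 in
lemma blocks2_ok : blocks2.all blkB = true := by decide +kernel

set_option maxRecDepth 100000 in
lemma blocks3_ok : blocks3.all blkB = true := by decide +kernel

lemma chs_len : ∀ c ∈ chs, c.length = 439 := by decide +kernel

end RobinAux


namespace RobinAux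

lemma not_prime_aux {m R B : ℕ} (l : List ℕ) (hR : R = l.prod) (hl : ∀ a ∈ l, 0 < a ∧ a ≤ B)
    (hm : B < m) (hg : Nat.gcd m R ≠ 1) : ¬ m.Prime := by
  intro hp
  have h1 : m ∣ R := by
    by_contra h
    exact hg ((Nat.Prime.coprime_iff_not_dvd hp).2 h)
  rw [hR] at h1
  obtain ⟨a, ha, hd⟩ := (Nat.Prime.prime hp).dvd_prod_iff.1 h1
  have := Nat.le_of_dvd (hl a ha).1 hd
  have := (hl a ha).2
  omega

lemma compB_sound {m : ℕ} (h : compB m = true) : ¬ m.Prime := by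
  simp only [compB, Bool.or_eq_true, Bool.and_eq_true, Bool.not_eq_true'] at h
  have conv : ∀ a b : ℕ, Nat.beq a b = false → a ≠ b := by
    intro a b h e
    subst e
    simp at h
  rcases h with ⟨h1, h2⟩ | ⟨h1, h2⟩ | ⟨h1, h2⟩
  · exact not_prime_aux (B := 3) [2, 3] rfl (by decide) (Nat.blt_eq.mp h1) (conv _ _ h2)
  · exact not_prime_aux (B := 13) [2, 3, 5, 7, 11, 13] rfl (by decide) (Nat.blt_eq.mp h1) (conv _ _ h2)
  · exact not_prime_aux (B := 181) [2, 3, 5, 7, 11, 13, 17, 19, 23, 29, 31, 37, 41, 43, 47, 53, 59, 61, 67, 71,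
      73, 79, 83, 89, 97, 101, 103, 107, 109, 113, 127, 131, 137, 139, 149, 151, 157, 163, 167, 173, 179, 181]
      (by decide +kernel) (by decide +kernel) (Nat.blt_eq.mp h1) (conv _ _ h2)

lemma crB_sound (n m : ℕ) (h : crB n m = true) : Nat.count Nat.Prime (m + n) ≤ Nat.count Nat.Prime m := by
  induction n generalizing m with
  | zero => simp
  | succ n ih =>
    rw [crB, Bool.and_eq_true] at h
    have h1 := ih (m + 1) h.2
    rw [Nat.count_succ, if_neg (compB_sound h.1)] at h1
    rw [show m + (n + 1) = m + 1 + n by ring]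
    simpa using h1

lemma chkB_sound (l : List ℕ) (a c : ℕ) (h : chkB a l = true) (hc : Nat.count Nat.Prime (a + 1) ≤ c) :
    (∀ i < l.length, l.getD i 0 ≤ np (c + i) ∧ a < l.getD i 0) ∧
    Nat.count Nat.Prime (lastB a l + 1) ≤ c + l.length ∧ a ≤ lastB a l := by
  induction l generalizing a c with
  | nil => simpa [lastB] using hc
  | cons b t ih =>
    rw [chkB, Bool.and_eq_true, Bool.and_eq_true] at h
    obtain ⟨⟨h1, h2⟩, h3⟩ := h
    have h1 : a < b := Nat.blt_eq.mp h1
    have h4 := crB_sound _ _ h2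
    rw [show a + 1 + (b - a - 1) = b by omega] at h4
    have h5 : Nat.count Nat.Prime (b + 1) ≤ c + 1 := by
      rw [Nat.count_succ]
      split_ifs <;> omega
    obtain ⟨i1, i2, i3⟩ := ih b (c + 1) h3 h5
    refine ⟨?_, ?_, ?_⟩
    · intro i hi
      rcases i with _ | i
      · exact ⟨np_lower (h4.trans hc), h1⟩
      · have := i1 i (by simpa using hi)
        rw [List.getD_cons_succ, show c + (i + 1) = c + 1 + i by ring]
        exact ⟨this.1, by omega⟩
    · rw [lastB, List.length_cons]
      omega
    · rw [lastB]; omega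

lemma chkL_sound (ll : List (List ℕ)) (a c : ℕ) (h : chkL a ll = true) (hc : Nat.count Nat.Prime (a + 1) ≤ c) :
    ∀ i < ll.flatten.length, ll.flatten.getD i 0 ≤ np (c + i) ∧ a < ll.flatten.getD i 0 := by
  induction ll generalizing a c with
  | nil => simp
  | cons l t ih =>
    rw [chkL, Bool.and_eq_true] at h
    obtain ⟨j1, j2, j3⟩ := chkB_sound l a c h.1 hc
    have j := ih _ _ h.2 j2
    intro i hi
    rw [List.flatten_cons] at hi ⊢
    rcases lt_or_ge i l.length with h4 | h4
    · rw [List.getD_append _ _ _ _ h4]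
      exact j1 i h4
    · rw [List.getD_append_right _ _ _ _ h4]
      rw [List.length_append] at hi
      have := j (i - l.length) (by omega)
      rw [show c + l.length + (i - l.length) = c + i by omega] at this
      exact ⟨this.1, by omega⟩

def gl (i : ℕ) : ℕ := chs.flatten.getD i 0

lemma flat_len : chs.flatten.length = 3512 := by
  rw [List.length_flatten, List.map_congr_left chs_len]
  rfl

lemma gl_le (i : ℕ) (hi : i < 3512) : gl i ≤ np i ∧ 2 ≤ gl i := by
  have h := chkL_sound _ 1 0 chk_ok (by decide +kernel) i (by
    rw [List.flatten_append, List.length_append, flat_len]; omega)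
  rw [List.flatten_append, List.getD_append _ _ _ _ (by rw [flat_len]; exact hi), zero_add] at h
  exact ⟨h.1, h.2⟩

lemma np_big : 32768 ≤ np 3512 := by
  have h := chkL_sound _ 1 0 chk_ok (by decide +kernel) 3512 (by
    rw [List.flatten_append, List.length_append, flat_len]; simp)
  rw [List.flatten_append, List.getD_append_right _ _ _ _ (by rw [flat_len]), zero_add, flat_len] at h
  exact h.1

lemma plB_append (f : ℕ → ℕ) (l m : List ℕ) (k : ℕ) : plB f (l ++ m) k = plB f l k * plB f m (k - l.length) := by
  induction l generalizing k with
  | nil => simp [plB]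
  | cons a t ih =>
    rcases k with _ | k
    · rw [List.cons_append, plB, plB, Nat.zero_sub]
      rcases m with _ | ⟨b, m⟩ <;> simp [plB]
    · rw [List.cons_append, plB, plB, ih, List.length_cons, Nat.add_sub_add_right, mul_assoc]

lemma pllB_eq (f : ℕ → ℕ) (ll : List (List ℕ)) (hl : ∀ c ∈ ll, c.length = 439) (k : ℕ) :
    pllB f ll k = plB f ll.flatten k := by
  induction ll generalizing k with
  | nil => simp [pllB, plB]
  | cons c t ih =>
    rw [pllB, List.flatten_cons, plB_append, ih (fun c hc => hl c (List.mem_cons_of_mem _ hc)),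
      hl c List.mem_cons_self]

lemma plB_prod (f : ℕ → ℕ) (l : List ℕ) (k : ℕ) (hk : k ≤ l.length) :
    plB f l k = ∏ i ∈ range k, f (l.getD i 0) := by
  induction l generalizing k with
  | nil =>
    have : k = 0 := by simpa using hk
    subst this; simp [plB]
  | cons a t ih =>
    rcases k with _ | k
    · simp [plB]
    · rw [plB, Finset.prod_range_succ', ih k (by simpa using hk), mul_comm]
      simp

lemma pll_gl (f : ℕ → ℕ) (k : ℕ) (hk : k ≤ 3512) : pllB f chs k = ∏ i ∈ range k, f (gl i) := by
  rw [pllB_eq f chs chs_len, plB_prod f _ k (by rw [flat_len]; exact hk)]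
  rfl

lemma gamma_low : 0.57719 ≤ Real.eulerMascheroniConstant := by
  have h := HH_le (m := 64) (by norm_num)
  rw [HH_hq] at h
  have h1 : (4.7438 + 0.00009 : ℚ) ≤ hq 64 := by decide +kernel
  have h2 : ((4.7438 + 0.00009 : ℚ) : ℝ) ≤ (hq 64 : ℝ) := by exact_mod_cast h1
  have h3 : Real.log ((64 : ℕ) : ℝ) = 6 * Real.log 2 := by
    rw [show ((64 : ℕ) : ℝ) = 2 ^ 6 by norm_num, Real.log_pow]; norm_num
  rw [h3] at h
  have := Real.log_two_lt_d9
  push_cast at h h2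
  norm_num at h h2 ⊢
  linarith

lemma exp_gamma_low : 1.781 ≤ Real.exp Real.eulerMascheroniConstant := by
  refine le_trans ?_ (Real.exp_le_exp.2 gamma_low)
  refine le_trans ?_ (Real.sum_le_exp_of_nonneg (by norm_num) 9)
  simp only [Finset.sum_range_succ, Finset.sum_range_zero, Nat.factorial]
  norm_num

lemma exp_small : Real.exp (1 / 1024) ≤ 1074790913 / 2 ^ 30 := by
  have h := Real.exp_bound' (x := 1 / 1024) (by norm_num) (by norm_num) (n := 3) (by norm_num)
  refine h.trans ?_
  simp only [Finset.sum_range_succ, Finset.sum_range_zero, Nat.factorial]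
  norm_num

end RobinAux


namespace RobinAux

lemma log_prod_gl (k : ℕ) (hk : k ≤ 3512) :
    Real.log ((pllB (fun p => p) chs k : ℕ) : ℝ) ≤ ∑ i ∈ range k, Real.log (np i) := by
  rw [pll_gl _ k hk, Nat.cast_prod, Real.log_prod]
  · apply Finset.sum_le_sum
    intro i hi
    rw [mem_range] at hi
    have h := gl_le i (by omega)
    apply Real.log_le_log
    · exact_mod_cast (by omega : 0 < gl i)
    · exact_mod_cast h.1
  · intro i hi
    rw [mem_range] at hi
    have h := gl_le i (by omega)
    exact_mod_cast (by omega : gl i ≠ 0)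

lemma pll_pos (k : ℕ) (hk : k ≤ 3512) : 0 < pllB (fun p => p) chs k := by
  rw [pll_gl _ k hk]
  apply Finset.prod_pos
  intro i hi
  rw [mem_range] at hi
  have h := gl_le i (by omega)
  omega

lemma pll_pos' (k : ℕ) (hk : k ≤ 3512) : 0 < pllB (fun p => p - 1) chs k := by
  rw [pll_gl _ k hk]
  apply Finset.prod_pos
  intro i hi
  rw [mem_range] at hi
  have h := gl_le i (by omega)
  show 0 < gl i - 1
  omega

lemma exp_sum_le (k : ℕ) (hk : k ≤ 3512) :
    Real.exp (∑ i ∈ range k, -Real.log (1 - 1 / (np i : ℝ))) ≤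
      ((pllB (fun p => p) chs k : ℕ) : ℝ) / ((pllB (fun p => p - 1) chs k : ℕ) : ℝ) := by
  rw [Real.exp_sum, pll_gl _ k hk, pll_gl _ k hk, Nat.cast_prod, Nat.cast_prod, ← Finset.prod_div_distrib]
  apply Finset.prod_le_prod
  · intro i _; exact (Real.exp_pos _).le
  · intro i hi
    rw [mem_range] at hi
    obtain ⟨h1, h2⟩ := gl_le i (by omega)
    have h1' : (gl i : ℝ) ≤ np i := by exact_mod_cast h1
    have h2' : (2 : ℝ) ≤ gl i := by exact_mod_cast h2
    rw [Real.exp_neg, Real.exp_log (one_sub_pos (np_prime i)), Nat.cast_sub (by omega), Nat.cast_one]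
    rw [one_sub_div (by linarith), inv_div, div_le_div_iff₀ (by linarith) (by linarith)]
    nlinarith

lemma blk_sound {k0 k1 T0 s j : ℕ} (h : blkB (k0, k1, T0, s, j) = true) (h0 : k0 ≤ 3512) (h1 : k1 ≤ 3512)
    (hT0 : T0 ≤ 3512) {k T : ℕ} (hk0 : k0 ≤ k) (hk1 : k ≤ k1) (hT : T0 ≤ T) :
    ∃ A : ℝ, 1 < A ∧ A ≤ ∑ i ∈ range k, Real.log (np i) + ∑ i ∈ range T, Real.log (np i) ∧
      Real.exp (∑ i ∈ range k, -Real.log (1 - 1 / (np i : ℝ))) <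
      Real.exp Real.eulerMascheroniConstant * Real.log A := by
  simp only [blkB, Bool.and_eq_true] at h
  obtain ⟨c1, c2, c3⟩ := h
  have c1 := Nat.le_of_ble_eq_true c1
  have c2 := Nat.le_of_ble_eq_true c2
  have c3 := Nat.blt_eq.mp c3
  have p1 := pll_pos k0 h0
  have p2 := pll_pos T0 hT0
  have p4 := pll_pos' k1 h1
  have l1 := log_prod_gl k0 h0
  have l2 := log_prod_gl T0 hT0
  have l3 := exp_sum_le k1 h1
  generalize pllB (fun p => p) chs k0 = A0 at *
  generalize pllB (fun p => p) chs T0 = B0 at *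
  generalize pllB (fun p => p) chs k1 = P1 at *
  generalize pllB (fun p => p - 1) chs k1 = Q1 at *
  have p1' : (0 : ℝ) < A0 := by exact_mod_cast p1
  have p2' : (0 : ℝ) < B0 := by exact_mod_cast p2
  have p4' : (0 : ℝ) < Q1 := by exact_mod_cast p4
  have c1' : (2 : ℝ) ^ s ≤ ((A0 : ℝ) * B0) ^ 8 := by exact_mod_cast c1
  have c2' : (P1 : ℝ) * 1024000 ≤ 1781 * j * Q1 := by exact_mod_cast c2
  have c3' : (1074790913 : ℝ) ^ j * 80000 < 6931 * s * 2 ^ (30 * j) := by exact_mod_cast c3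
  set A : ℝ := 6931 * s / 80000 with hA
  have e1 : Real.exp ((j : ℝ) / 1024) < A := by
    have : Real.exp ((j : ℝ) / 1024) = Real.exp (1 / 1024) ^ j := by
      rw [← Real.exp_nat_mul]; congr 1; ring
    rw [this]
    refine (pow_le_pow_left₀ (Real.exp_pos _).le exp_small j).trans_lt ?_
    rw [div_pow, ← pow_mul, hA, div_lt_div_iff₀ (by positivity) (by norm_num)]
    exact c3'
  have e2 : 1 < A := lt_of_le_of_lt (Real.one_le_exp (by positivity)) e1
  have e3 : (j : ℝ) / 1024 < Real.log A := (Real.lt_log_iff_exp_lt (by linarith)).2 e1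
  refine ⟨A, e2, ?_, ?_⟩
  · have h3 := Real.log_le_log (by positivity) c1'
    rw [Real.log_pow, Real.log_pow, Real.log_mul p1'.ne' p2'.ne'] at h3
    have h4 : ∑ i ∈ range k0, Real.log (np i) ≤ ∑ i ∈ range k, Real.log (np i) := by
      apply Finset.sum_le_sum_of_subset_of_nonneg
      · intro i hi; rw [mem_range] at *; omega
      · intro i _ _; exact Real.log_natCast_nonneg _
    have h5 : ∑ i ∈ range T0, Real.log (np i) ≤ ∑ i ∈ range T, Real.log (np i) := by
      apply Finset.sum_le_sum_of_subset_of_nonneg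
      · intro i hi; rw [mem_range] at *; omega
      · intro i _ _; exact Real.log_natCast_nonneg _
    have h6 : (s : ℝ) * 0.6931 ≤ s * Real.log 2 := by
      apply mul_le_mul_of_nonneg_left _ (by positivity)
      have := Real.log_two_gt_d9; linarith
    push_cast at h3
    rw [hA]
    linarith
  · have h4 : Real.exp (∑ i ∈ range k, -Real.log (1 - 1 / (np i : ℝ))) ≤
        Real.exp (∑ i ∈ range k1, -Real.log (1 - 1 / (np i : ℝ))) := by
      apply Real.exp_le_exp.2
      apply Finset.sum_le_sum_of_subset_of_nonneg
      · intro i hi; rw [mem_range] at *; omega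
      · intro i _ _
        rw [neg_nonneg]
        apply Real.log_nonpos (one_sub_pos (np_prime i)).le
        have : 0 ≤ 1 / (np i : ℝ) := by positivity
        linarith
    have h5 : (P1 : ℝ) / Q1 ≤ 1.781 * (j / 1024) := by
      rw [div_le_iff₀ p4']; linarith
    have h6 : 1.781 * ((j : ℝ) / 1024) ≤ Real.exp Real.eulerMascheroniConstant * (j / 1024) :=
      mul_le_mul_of_nonneg_right exp_gamma_low (by positivity)
    have h7 := mul_lt_mul_of_pos_left e3 (Real.exp_pos Real.eulerMascheroniConstant)
    linarith

def covB (d e : ℕ) : ℕ → List (ℕ × ℕ × ℕ × ℕ × ℕ) → Bool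
  | a, [] => decide (e < a)
  | a, b :: t => decide (b.1 = a ∧ b.1 ≤ 3512 ∧ b.2.1 ≤ 3512 ∧ b.2.2.1 ≤ 3512 ∧ d * b.2.2.1 < b.1 + d) && covB d e (b.2.1 + 1) t

lemma cov_sound (d e : ℕ) (bl : List (ℕ × ℕ × ℕ × ℕ × ℕ)) (a : ℕ) (hc : covB d e a bl = true)
    (hb : bl.all blkB = true) (k T : ℕ) (hk : a ≤ k) (hke : k ≤ e) (hT : k ≤ d * T) :
    ∃ A : ℝ, 1 < A ∧ A ≤ ∑ i ∈ range k, Real.log (np i) + ∑ i ∈ range T, Real.log (np i) ∧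
      Real.exp (∑ i ∈ range k, -Real.log (1 - 1 / (np i : ℝ))) <
      Real.exp Real.eulerMascheroniConstant * Real.log A := by
  induction bl generalizing a with
  | nil =>
    simp only [covB, decide_eq_true_eq] at hc
    omega
  | cons b t ih =>
    obtain ⟨k0, k1, T0, s, j⟩ := b
    rw [List.all_cons, Bool.and_eq_true] at hb
    simp only [covB, Bool.and_eq_true, decide_eq_true_eq] at hc
    obtain ⟨⟨h1, h2, h3, h4, h5⟩, h6⟩ := hc
    rcases le_or_gt k k1 with h | h
    · refine blk_sound hb.1 h2 h3 h4 (by omega) h ?_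
      by_contra hlt
      have : d * (T + 1) ≤ d * T0 := Nat.mul_le_mul_left d (by omega)
      rw [Nat.mul_add] at this
      omega
    · exact ih (k1 + 1) h6 hb.2 h

lemma np_mono {a b : ℕ} (h : a ≤ b) : np a ≤ np b := Nat.nth_monotone Nat.infinite_setOfPred_prime h

lemma all_cases (k T : ℕ) (h : (18 ≤ k ∧ k ≤ 2 * T) ∨ (39 ≤ k ∧ k ≤ 3 * T) ∨ (969672728 ≤ k ∧ k ≤ 14 * T)) :
    ∃ A : ℝ, 1 < A ∧ A ≤ ∑ i ∈ range k, Real.log (np i) + ∑ i ∈ range T, Real.log (np i) ∧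
      Real.exp (∑ i ∈ range k, -Real.log (1 - 1 / (np i : ℝ))) <
      Real.exp Real.eulerMascheroniConstant * Real.log A := by
  have case2 : 39 ≤ k → k ≤ 3 * T → ∃ A : ℝ, 1 < A ∧ A ≤ ∑ i ∈ range k, Real.log (np i) + ∑ i ∈ range T, Real.log (np i) ∧
      Real.exp (∑ i ∈ range k, -Real.log (1 - 1 / (np i : ℝ))) <
      Real.exp Real.eulerMascheroniConstant * Real.log A := by
    intro h1 h2
    rcases le_or_gt k 3512 with h3 | h3
    · exact cov_sound 3 3512 blocks3 39 (by decide +kernel) blocks3_ok k T h1 h3 h2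
    · obtain ⟨m, rfl⟩ : ∃ m, k = m + 1 := ⟨k - 1, by omega⟩
      exact big2 m T (np_big.trans (np_mono (by omega))) (by omega) h2
  rcases h with ⟨h1, h2⟩ | ⟨h1, h2⟩ | ⟨h1, h2⟩
  · rcases le_or_gt k 38 with h3 | h3
    · exact cov_sound 2 38 blocks2 18 (by decide +kernel) blocks2_ok k T h1 h3 h2
    · exact case2 h3 (by omega)
  · exact case2 h1 h2
  · obtain ⟨m, rfl⟩ : ∃ m, k = m + 1 := ⟨k - 1, by omega⟩
    have h3 := np_ge (m - 11)
    rw [show m - 11 + 11 = m by omega] at h3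
    exact big3 m T (by omega) (by omega) h2

end RobinAux

theorem robin_of_many_higher_multiplicities (n : ℕ) (hn : 0 < n)
    (T : ℕ) (hT : T = (n.primeFactors.filter (fun p => p ^ 2 ∣ n)).card)
    (h : (18 ≤ n.primeFactors.card ∧ (n.primeFactors.card : ℝ) / 2 ≤ (T : ℝ)) ∨
         (39 ≤ n.primeFactors.card ∧ (n.primeFactors.card : ℝ) / 3 ≤ (T : ℝ)) ∨
         (969672728 ≤ n.primeFactors.card ∧ (n.primeFactors.card : ℝ) / 14 ≤ (T : ℝ))) :
    (ArithmeticFunction.sigma 1 n : ℝ) / n <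
      Real.exp Real.eulerMascheroniConstant * Real.log (Real.log n) := by
  have h' : (18 ≤ n.primeFactors.card ∧ n.primeFactors.card ≤ 2 * T) ∨
      (39 ≤ n.primeFactors.card ∧ n.primeFactors.card ≤ 3 * T) ∨
      (969672728 ≤ n.primeFactors.card ∧ n.primeFactors.card ≤ 14 * T) := by
    rcases h with ⟨h1, h2⟩ | ⟨h1, h2⟩ | ⟨h1, h2⟩
    · left
      refine ⟨h1, ?_⟩
      have : (n.primeFactors.card : ℝ) ≤ 2 * T := by linarith
      exact_mod_cast this
    · right; left
      refine ⟨h1, ?_⟩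
      have : (n.primeFactors.card : ℝ) ≤ 3 * T := by linarith
      exact_mod_cast this
    · right; right
      refine ⟨h1, ?_⟩
      have : (n.primeFactors.card : ℝ) ≤ 14 * T := by linarith
      exact_mod_cast this
  obtain ⟨A, hA1, hA2, hA3⟩ := RobinAux.all_cases _ T h'
  exact RobinAux.robin_red n hn T hT.le A hA1 hA2 hA3
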